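/- Fix p ∈ (0,1] and for each n ≥ 3 fix three distinct vertices s, a, b; let A := {a↛s}, B := {s↛b} be events for ⃗G(n,p) and let M be the number of edges of the underlying graph. Then as n → ∞: E(Cov(A,B | M)) = (3 − (4−2p)·e^{2p(1−p)/(2−p)²} + o(1))·(1 − p/2)^{2n−3}, and Var(P(A | M)) = 4·(e^{2p(1−p)/(2−p)²} − 1 + o(1))·(1 − p/2)^{2n−2}. -/

import Mathlib

open Filter Real

/-- Edges of the complete graph on `Fin n`: ordered pairs `(u,v)` with `u < v`. -/
abbrev Edge (n : ℕ) : Type := {e : Fin n × Fin n // e.1 < e.2}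

/-- A configuration of the random edge-orientation model: for each pair `u < v`,
`none` means no edge, `some true` means the directed edge `u → v`, and
`some false` means the directed edge `v → u`. -/
abbrev Config (n : ℕ) : Type := Edge n → Option Bool

/-- The directed edge relation determined by a configuration. -/
def DirEdge {n : ℕ} (f : Config n) (u v : Fin n) : Prop :=
  (∃ h : u < v, f ⟨(u, v), h⟩ = some true) ∨ (∃ h : v < u, f ⟨(v, u), h⟩ = some false)

/-- `Reaches f u v`: the configuration `f` contains a directed path from `u` to `v`
(paths of length `0` are allowed, so `Reaches f u u` always holds). -/
def Reaches {n : ℕ} (f : Config n) (u v : Fin n) : Prop :=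
  Relation.ReflTransGen (DirEdge f) u v

/-- The probability of an event under a weight function on a finite sample space. -/
noncomputable def prWeight {α : Type*} [Fintype α] (w : α → ℝ) (E : Set α) : ℝ :=
  ∑ x, E.indicator w x

/-- The weight of one edge state in `⃗G(n,p)`: no edge has probability `1 - p`
and each of the two orientations has probability `p/2`. -/
noncomputable def edgeWeight (p : ℝ) : Option Bool → ℝ
  | none => 1 - p
  | some _ => p / 2

/-- The probability of an event in the random directed graph `⃗G(n,p)`. -/
noncomputable def PrGnp (n : ℕ) (p : ℝ) (E : Set (Config n)) : ℝ :=
  prWeight (fun f => ∏ e : Edge n, edgeWeight p (f e)) E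

/-- The number of present edges of a configuration. -/
def edgeCount {n : ℕ} (f : Config n) : ℕ :=
  (Finset.univ.filter fun e : Edge n => (f e).isSome).card

/-- The probability of an event in the random directed graph `⃗G(n,m)`:
the underlying graph is uniform among the graphs with exactly `m` edges, and each
present edge is oriented in one of its two directions with probability `1/2`,
independently over edges. -/
noncomputable def PrGnm (n m : ℕ) (E : Set (Config n)) : ℝ :=
  prWeight (fun f => if edgeCount f = m
      then ((Nat.choose (Nat.choose n 2) m : ℝ) * 2 ^ m)⁻¹ else 0) E

/-- The generating function, evaluated at `t`, of the size of the intersection of a fixed `K`-set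
with a uniform `k`-subset of an `L`-set. -/
noncomputable def hypergeomGF (L : ℕ) (t : ℝ) (K k : ℕ) : ℝ :=
  ∑ j ∈ Finset.range (L + 1),
    (t - 1) ^ j * ((K.choose j : ℝ) * (k.choose j : ℝ) / (L.choose j : ℝ))

lemma hypergeomGF_comm (L : ℕ) (t : ℝ) (K k : ℕ) :
    hypergeomGF L t K k = hypergeomGF L t k K := by
  simp only [hypergeomGF, mul_comm]

lemma hypergeomGF_zero (L : ℕ) (t : ℝ) (K : ℕ) : hypergeomGF L t K 0 = 1 := by
  unfold hypergeomGF
  rw [Finset.sum_eq_single 0]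
  · simp
  · intro j _ hj
    simp [Nat.choose_eq_zero_of_lt (Nat.pos_of_ne_zero hj)]
  · simp

lemma pow_card_eq_sum_powerset {E : Type*} (A : Finset E) (t : ℝ) :
    t ^ A.card = ∑ J ∈ A.powerset, (t - 1) ^ J.card := by
  have h := Finset.sum_pow_mul_eq_add_pow (t - 1) 1 A
  simpa using h.symm

lemma sum_powersetCard_pow_card_inter {E : Type*} [Fintype E] [DecidableEq E] (A : Finset E)
    (t : ℝ) {k : ℕ} :
    ∑ B ∈ Finset.powersetCard k (Finset.univ : Finset E), t ^ (A ∩ B).card =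
      ((Fintype.card E).choose k : ℝ) * hypergeomGF (Fintype.card E) t A.card k := by
  have hsum : ∀ B : Finset E, t ^ (A ∩ B).card =
      ∑ J ∈ A.powerset, if J ⊆ B then (t - 1) ^ J.card else 0 := by
    intro B
    rw [pow_card_eq_sum_powerset, ← Finset.sum_filter]
    apply Finset.sum_congr _ (fun _ _ => rfl)
    ext J
    rw [Finset.mem_powerset, Finset.mem_filter, Finset.mem_powerset, Finset.subset_inter_iff]
  have hcount : ∀ J : Finset E,
      ∑ B ∈ Finset.powersetCard k (Finset.univ : Finset E), (if J ⊆ B then (t - 1) ^ J.card else 0)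
      = (t - 1) ^ J.card * ((((Fintype.card E).choose k : ℝ) * (k.choose J.card : ℝ)) /
          ((Fintype.card E).choose J.card : ℝ)) := by
    intro J
    have hJ : J.card ≤ Fintype.card E := Finset.card_le_univ J
    have hpos : (0 : ℝ) < ((Fintype.card E).choose J.card : ℝ) := by
      exact_mod_cast Nat.choose_pos hJ
    rw [← Finset.sum_filter, Finset.sum_const, nsmul_eq_mul, mul_comm]
    congr 1
    rw [eq_div_iff hpos.ne']
    by_cases hjk : J.card ≤ k
    · rw [Finset.card_filter_powersetCard_subset _ _ _ (Finset.subset_univ J) hjk, Finset.card_univ]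
      have := Nat.choose_mul (n := Fintype.card E) hjk
      rw [mul_comm]
      exact_mod_cast this.symm
    · rw [Nat.choose_eq_zero_of_lt (not_le.mp hjk), Finset.filter_eq_empty_iff.mpr]
      · simp
      · intro B hB hJB
        have := Finset.card_le_card hJB
        rw [(Finset.mem_powersetCard.mp hB).2] at this
        exact hjk this
  simp_rw [hsum]
  rw [Finset.sum_comm]
  simp_rw [hcount]
  rw [Finset.sum_powerset_apply_card (fun j => (t - 1) ^ j *
    ((((Fintype.card E).choose k : ℝ) * (k.choose j : ℝ)) / ((Fintype.card E).choose j : ℝ)))]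
  rw [hypergeomGF, Finset.mul_sum]
  have hA : A.card + 1 ≤ Fintype.card E + 1 := Nat.succ_le_succ (Finset.card_le_univ A)
  rw [← Finset.sum_subset (Finset.range_subset_range.mpr hA)]
  · apply Finset.sum_congr rfl
    intro j _
    rw [nsmul_eq_mul]
    ring
  · intro j _ hj
    rw [Finset.mem_range, not_lt] at hj
    simp [Nat.choose_eq_zero_of_lt (Nat.lt_of_succ_le hj)]

lemma choose_mul_choose_mul_factorial_le {K k L : ℕ} (hK : K ≤ L) (hk : k ≤ L) (hL : 0 < L)
    (j : ℕ) : (K.choose j : ℝ) * (k.choose j : ℝ) * (j.factorial : ℝ) ≤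
      ((K : ℝ) * k / L) ^ j * (L.choose j : ℝ) := by
  induction j with
  | zero => simp
  | succ j ih =>
    by_cases hj : j + 1 ≤ K ∧ j + 1 ≤ k
    · obtain ⟨h1, h2⟩ := hj
      have e : ∀ N : ℕ, j ≤ N → (N.choose (j + 1) : ℝ) * (j + 1) = N.choose j * ((N : ℝ) - j) := by
        intro N hN
        have := Nat.choose_succ_right_eq N j
        rw [← Nat.cast_sub hN]
        exact_mod_cast this
      have eK := e K (by omega)
      have ek := e k (by omega)
      have eL := e L (by omega)
      have hj0 : (0 : ℝ) < (j : ℝ) + 1 := by positivity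
      have hL' : (0 : ℝ) < L := by exact_mod_cast hL
      have hKL : (K : ℝ) ≤ L := by exact_mod_cast hK
      have hkL : (k : ℝ) ≤ L := by exact_mod_cast hk
      have hjK : (j : ℝ) + 1 ≤ K := by exact_mod_cast h1
      have hjk : (j : ℝ) + 1 ≤ k := by exact_mod_cast h2
      have hj1 : (0 : ℝ) ≤ j := by positivity
      have key : ((K : ℝ) - j) * (k - j) ≤ (K : ℝ) * k / L * (L - j) := by
        rw [div_mul_eq_mul_div, le_div_iff₀ hL']
        have : (K : ℝ) * k ≤ L * (K + k - j) := by nlinarith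
        nlinarith
      have hfac : ((j + 1).factorial : ℝ) = (j + 1) * j.factorial := by
        push_cast [Nat.factorial_succ]; ring
      rw [hfac]
      have : ((K.choose (j + 1) : ℝ) * (k.choose (j + 1) : ℝ) * ((j + 1) * j.factorial)) * (j + 1) ≤
          (((K : ℝ) * k / L) ^ (j + 1) * (L.choose (j + 1) : ℝ)) * (j + 1) := by
        calc _ = (((K.choose (j + 1) : ℝ) * (j + 1)) * ((k.choose (j + 1) : ℝ) * (j + 1)))
              * j.factorial := by ring
          _ = ((K.choose j : ℝ) * (k.choose j : ℝ) * (j.factorial : ℝ)) *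
              (((K : ℝ) - j) * (k - j)) := by rw [eK, ek]; ring
          _ ≤ (((K : ℝ) * k / L) ^ j * (L.choose j : ℝ)) * ((K : ℝ) * k / L * (L - j)) := by
              apply mul_le_mul ih key _ (by positivity)
              apply mul_nonneg <;> linarith
          _ = ((K : ℝ) * k / L) ^ (j + 1) * ((L.choose j : ℝ) * (L - j)) := by ring
          _ = _ := by rw [← eL]; ring
      exact le_of_mul_le_mul_right this hj0
    · have : (K.choose (j + 1) : ℝ) * (k.choose (j + 1) : ℝ) = 0 := by
        rw [not_and_or, not_le, not_le] at hj
        rcases hj with h | h <;> simp [Nat.choose_eq_zero_of_lt h]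
      rw [this, zero_mul]
      positivity

lemma choose_mul_choose_div_le {K k L : ℕ} (hK : K ≤ L) (hk : k ≤ L) (hL : 0 < L)
    (j : ℕ) : (K.choose j : ℝ) * (k.choose j : ℝ) / (L.choose j : ℝ) ≤
      ((K : ℝ) * k / L) ^ j / (j.factorial : ℝ) := by
  by_cases hj : j ≤ L
  · have hpos : (0 : ℝ) < (L.choose j : ℝ) := by exact_mod_cast Nat.choose_pos hj
    rw [div_le_div_iff₀ hpos (by positivity)]
    exact choose_mul_choose_mul_factorial_le hK hk hL j
  · rw [Nat.choose_eq_zero_of_lt (not_le.mp hj)]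
    simp only [Nat.cast_zero, div_zero]
    positivity

lemma hypergeomGF_le_exp {K k L : ℕ} (hK : K ≤ L) (hk : k ≤ L) (hL : 0 < L) {r : ℝ} (hr : 0 ≤ r) :
    hypergeomGF L (1 + r) K k ≤ Real.exp (r * ((K : ℝ) * k / L)) := by
  refine le_trans ?_ (Real.sum_le_exp_of_nonneg (x := r * ((K : ℝ) * k / L)) (by positivity)
    (L + 1))
  apply Finset.sum_le_sum
  intro j _
  rw [add_sub_cancel_left, mul_pow, mul_div_assoc (r ^ j)]
  exact mul_le_mul_of_nonneg_left (choose_mul_choose_div_le hK hk hL j) (by positivity)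

/-- The variance parameter `p (1 - p) / (2 - p) ^ 2`. -/
noncomputable def varParam (p : ℝ) : ℝ := p * (1 - p) / (2 - p) ^ 2

lemma sum_weight_mul_half_pow {E : Type*} [Fintype E] [DecidableEq E] {p : ℝ}
    (hp : p ∈ Set.Ioc (0 : ℝ) 1) (S S' : Finset E) :
    ∑ X : Finset E, p ^ X.card * (1 - p) ^ (Fintype.card E - X.card) *
        ((1 / 2 : ℝ) ^ (S ∩ X).card * (1 / 2 : ℝ) ^ (S' ∩ X).card) =
      (1 - p / 2) ^ (S.card + S'.card) * (1 + varParam p) ^ (S ∩ S').card := by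
  have hpow : ∀ (c : ℝ) (A B : Finset E),
      c ^ (A ∩ B).card = ∏ e ∈ B, if e ∈ A then c else 1 := by
    intro c A B
    rw [Finset.prod_ite_mem, Finset.prod_const, Finset.inter_comm]
  have hpow' : ∀ (c : ℝ) (A : Finset E), c ^ A.card = ∏ e : E, if e ∈ A then c else 1 := by
    intro c A
    rw [← hpow, Finset.inter_univ]
  have h2p : (2 - p) ≠ 0 := by have := hp.2; linarith
  calc _ = ∑ X ∈ (Finset.univ : Finset E).powerset,
        (∏ e ∈ X, p * ((if e ∈ S then (1 / 2 : ℝ) else 1) * (if e ∈ S' then (1 / 2 : ℝ) else 1))) *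
          ∏ e ∈ Finset.univ \ X, (1 - p) := by
        rw [Finset.powerset_univ]
        apply Finset.sum_congr rfl
        intro X _
        rw [hpow, hpow, Finset.prod_mul_distrib, Finset.prod_mul_distrib, Finset.prod_const,
          Finset.prod_const, Finset.card_sdiff_of_subset (Finset.subset_univ X), Finset.card_univ]
        ring
    _ = ∏ e : E, (p * ((if e ∈ S then (1 / 2 : ℝ) else 1) * (if e ∈ S' then (1 / 2 : ℝ) else 1))
          + (1 - p)) := (Finset.prod_add _ _ _).symm
    _ = ∏ e : E, ((if e ∈ S then (1 - p / 2) else 1) * (if e ∈ S' then (1 - p / 2) else 1) *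
          (if e ∈ S ∩ S' then 1 + varParam p else 1)) := by
        apply Finset.prod_congr rfl
        intro e _
        by_cases h1 : e ∈ S <;> by_cases h2 : e ∈ S' <;>
          simp only [h1, h2, if_true, if_false, Finset.mem_inter, and_true, and_false, and_self]
        · unfold varParam
          field_simp
          ring
        · ring
        · ring
        · ring
    _ = _ := by
        rw [Finset.prod_mul_distrib, Finset.prod_mul_distrib, ← hpow', ← hpow', ← hpow', pow_add]

/-- The second moment of a product of two avoidance probabilities under the binomial law. -/
lemma sum_binomial_mul_hypergeomGF {p : ℝ} (hp : p ∈ Set.Ioc (0 : ℝ) 1) {L K k : ℕ}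
    (hK : K ≤ L) (hk : k ≤ L) :
    ∑ m ∈ Finset.range (L + 1), (L.choose m : ℝ) * p ^ m * (1 - p) ^ (L - m) *
        (hypergeomGF L (1 / 2) K m * hypergeomGF L (1 / 2) k m) =
      (1 - p / 2) ^ (K + k) * hypergeomGF L (1 + varParam p) K k := by
  obtain ⟨S, -, hS⟩ := Finset.exists_subset_card_eq
    (show K ≤ (Finset.univ : Finset (Fin L)).card by simpa using hK)
  have hmain : ∀ X : Finset (Fin L), (L.choose k : ℝ) * hypergeomGF L (1 / 2) k X.card =
      ∑ B ∈ Finset.powersetCard k (Finset.univ : Finset (Fin L)), (1 / 2 : ℝ) ^ (B ∩ X).card := by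
    intro X
    have := sum_powersetCard_pow_card_inter X (1 / 2) (k := k)
    rw [Fintype.card_fin] at this
    rw [hypergeomGF_comm, ← this]
    simp only [Finset.inter_comm]
  have hS' : ∀ m, (L.choose m : ℝ) * hypergeomGF L (1 / 2) K m =
      ∑ X ∈ Finset.powersetCard m (Finset.univ : Finset (Fin L)), (1 / 2 : ℝ) ^ (S ∩ X).card := by
    intro m
    have := sum_powersetCard_pow_card_inter S (1 / 2) (k := m)
    rw [Fintype.card_fin, hS] at this
    exact this.symm
  have hpos : (0 : ℝ) < (L.choose k : ℝ) := by exact_mod_cast Nat.choose_pos hk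
  apply mul_left_cancel₀ hpos.ne'
  calc _ = ∑ m ∈ Finset.range (L + 1),
          ∑ X ∈ Finset.powersetCard m (Finset.univ : Finset (Fin L)),
            p ^ X.card * (1 - p) ^ (L - X.card) * ((1 / 2 : ℝ) ^ (S ∩ X).card *
              ((L.choose k : ℝ) * hypergeomGF L (1 / 2) k X.card)) := by
        rw [Finset.mul_sum]
        apply Finset.sum_congr rfl
        intro m _
        have : ∀ X ∈ Finset.powersetCard m (Finset.univ : Finset (Fin L)),
            p ^ X.card * (1 - p) ^ (L - X.card) * ((1 / 2 : ℝ) ^ (S ∩ X).card *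
              ((L.choose k : ℝ) * hypergeomGF L (1 / 2) k X.card)) =
            (1 / 2 : ℝ) ^ (S ∩ X).card * (p ^ m * (1 - p) ^ (L - m) *
              ((L.choose k : ℝ) * hypergeomGF L (1 / 2) k m)) := by
          intro X hX
          rw [(Finset.mem_powersetCard.mp hX).2]
          ring
        rw [Finset.sum_congr rfl this, ← Finset.sum_mul, ← hS']
        ring
    _ = ∑ X : Finset (Fin L), p ^ X.card * (1 - p) ^ (L - X.card) * ((1 / 2 : ℝ) ^ (S ∩ X).card *
              ((L.choose k : ℝ) * hypergeomGF L (1 / 2) k X.card)) := by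
        rw [← Finset.powerset_univ, Finset.sum_powerset, Finset.card_univ, Fintype.card_fin]
    _ = ∑ B ∈ Finset.powersetCard k (Finset.univ : Finset (Fin L)), ∑ X : Finset (Fin L),
          p ^ X.card * (1 - p) ^ (Fintype.card (Fin L) - X.card) *
            ((1 / 2 : ℝ) ^ (S ∩ X).card * (1 / 2 : ℝ) ^ (B ∩ X).card) := by
        rw [Finset.sum_comm]
        apply Finset.sum_congr rfl
        intro X _
        rw [hmain, Finset.mul_sum, Finset.mul_sum, Fintype.card_fin]
    _ = ∑ B ∈ Finset.powersetCard k (Finset.univ : Finset (Fin L)),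
          (1 - p / 2) ^ (K + k) * (1 + varParam p) ^ (S ∩ B).card := by
        apply Finset.sum_congr rfl
        intro B hB
        rw [sum_weight_mul_half_pow hp, hS, (Finset.mem_powersetCard.mp hB).2]
    _ = _ := by
        have := sum_powersetCard_pow_card_inter S (1 + varParam p) (k := k)
        rw [Fintype.card_fin, hS] at this
        rw [← Finset.mul_sum, this]
        ring

section PrWeight

variable {α : Type*} [Fintype α] {w : α → ℝ}

lemma prWeight_nonneg (hw : ∀ x, 0 ≤ w x) (E : Set α) : 0 ≤ prWeight w E :=
  Finset.sum_nonneg fun x _ => Set.indicator_nonneg (fun y _ => hw y) x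

lemma prWeight_mono (hw : ∀ x, 0 ≤ w x) {E F : Set α} (h : E ⊆ F) :
    prWeight w E ≤ prWeight w F :=
  Finset.sum_le_sum fun _ _ => Set.indicator_le_indicator_of_subset h hw _

lemma prWeight_union_add_inter (E F : Set α) :
    prWeight w (E ∪ F) + prWeight w (E ∩ F) = prWeight w E + prWeight w F := by
  simp only [prWeight, ← Finset.sum_add_distrib]
  exact Finset.sum_congr rfl fun x _ => Set.indicator_union_add_inter_apply w E F x

lemma prWeight_union_le (hw : ∀ x, 0 ≤ w x) (E F : Set α) :
    prWeight w (E ∪ F) ≤ prWeight w E + prWeight w F := by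
  rw [← prWeight_union_add_inter]
  linarith [prWeight_nonneg hw (E ∩ F)]

lemma prWeight_biUnion_le (hw : ∀ x, 0 ≤ w x) {ι : Type*} (I : Finset ι) (E : ι → Set α) :
    prWeight w (⋃ i ∈ I, E i) ≤ ∑ i ∈ I, prWeight w (E i) := by
  classical
  induction I using Finset.induction_on with
  | empty => simp [prWeight]
  | insert i I hi ih =>
    rw [Finset.set_biUnion_insert, Finset.sum_insert hi]
    exact (prWeight_union_le hw _ _).trans (by linarith)

end PrWeight

lemma card_edge (n : ℕ) : Fintype.card (Edge n) = n.choose 2 := by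
  have h : Fintype.card (Edge n) + Fintype.card (Edge n) = n * (n - 1) := by
    have h1 : Fintype.card (Edge n) =
        (Finset.univ.filter fun d : Fin n × Fin n => d.1 < d.2).card := Fintype.card_subtype _
    have h2 : (Finset.univ.filter fun d : Fin n × Fin n => d.2 < d.1).card =
        (Finset.univ.filter fun d : Fin n × Fin n => d.1 < d.2).card := by
      refine Finset.card_bij' (fun d _ => d.swap) (fun d _ => d.swap) ?_ ?_ ?_ ?_ <;> simp
    have h3 : (Finset.univ.filter fun d : Fin n × Fin n => d.1 < d.2).card +
        (Finset.univ.filter fun d : Fin n × Fin n => d.2 < d.1).card =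
        (Finset.univ : Finset (Fin n)).offDiag.card := by
      rw [← Finset.card_union_of_disjoint]
      · congr 1
        ext d
        simp [Finset.mem_offDiag, lt_or_lt_iff_ne]
      · rw [Finset.disjoint_filter]
        intro d _ h
        exact h.asymm
    rw [h2, ← h1, Finset.offDiag_card, Finset.card_univ, Fintype.card_fin] at h3
    rw [h3, Nat.mul_sub, mul_one]
  rw [Nat.choose_two_right, ← h]
  omega

/-- The configurations containing no directed edge `u → v` with `(u, v) ∈ D`. -/
def avoid {n : ℕ} (D : Finset (Fin n × Fin n)) : Set (Config n) :=
  {f | ∀ d ∈ D, ¬ DirEdge f d.1 d.2}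

/-- The number of orientations of the edge `e` that belong to `D`. -/
def orientCount {n : ℕ} (D : Finset (Fin n × Fin n)) (e : Edge n) : ℕ :=
  (if (e.1.1, e.1.2) ∈ D then 1 else 0) + (if (e.1.2, e.1.1) ∈ D then 1 else 0)

/-- The states of the edge `e` whose orientation, if any, is not in `D`. -/
def allowedStates {n : ℕ} (D : Finset (Fin n × Fin n)) (e : Edge n) : Finset (Option Bool) :=
  Finset.univ.filter fun x => ¬ (x = some true ∧ (e.1.1, e.1.2) ∈ D) ∧
    ¬ (x = some false ∧ (e.1.2, e.1.1) ∈ D)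

lemma mem_avoid_iff {n : ℕ} (D : Finset (Fin n × Fin n)) (f : Config n) :
    f ∈ avoid D ↔ ∀ e, f e ∈ allowedStates D e := by
  simp only [avoid, Set.mem_ofPred_eq, allowedStates, Finset.mem_filter, Finset.mem_univ, true_and]
  constructor
  · intro h e
    refine ⟨fun h1 => h _ h1.2 (Or.inl ⟨e.2, h1.1⟩), fun h1 => h _ h1.2 (Or.inr ⟨e.2, h1.1⟩)⟩
  · rintro h ⟨u, v⟩ hd (⟨huv, h1⟩ | ⟨huv, h1⟩)
    · exact (h _).1 ⟨h1, hd⟩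
    · exact (h _).2 ⟨h1, hd⟩

lemma avoid_anti {n : ℕ} {D D' : Finset (Fin n × Fin n)} (h : D ⊆ D') :
    avoid D' ⊆ avoid D := fun _ hf d hd => hf d (h hd)

lemma avoid_union {n : ℕ} (D D' : Finset (Fin n × Fin n)) :
    avoid (D ∪ D') = avoid D ∩ avoid D' := by
  ext f
  simp only [avoid, Finset.mem_union, Set.mem_ofPred_eq, Set.mem_inter_iff]
  constructor
  · exact fun h => ⟨fun d hd => h d (Or.inl hd), fun d hd => h d (Or.inr hd)⟩
  · rintro ⟨h1, h2⟩ d (hd | hd)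
    exacts [h1 d hd, h2 d hd]

lemma sum_orientCount {n : ℕ} {D : Finset (Fin n × Fin n)} (hD : ∀ d ∈ D, d.1 ≠ d.2) :
    ∑ e, orientCount D e = D.card := by
  have h1 : ∑ e : Edge n, (if (e.1.1, e.1.2) ∈ D then 1 else 0) =
      (D.filter fun d => d.1 < d.2).card := by
    rw [← Finset.card_filter]
    refine Finset.card_bij (fun e _ => e.1) ?_ ?_ ?_
    · intro e he
      simpa [e.2] using he
    · intro e _ e' _ h
      exact Subtype.ext h
    · intro d hd
      rw [Finset.mem_filter] at hd
      exact ⟨⟨d, hd.2⟩, by simpa using hd.1, rfl⟩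
  have h2 : ∑ e : Edge n, (if (e.1.2, e.1.1) ∈ D then 1 else 0) =
      (D.filter fun d => ¬ d.1 < d.2).card := by
    rw [← Finset.card_filter]
    refine Finset.card_bij (fun e _ => e.1.swap) ?_ ?_ ?_
    · intro e he
      have := e.2.le
      simp only [Finset.mem_filter, Finset.mem_univ, true_and] at he
      simp [Prod.swap, he, this]
    · intro e _ e' _ h
      exact Subtype.ext (Prod.swap_injective h)
    · intro d hd
      rw [Finset.mem_filter] at hd
      exact ⟨⟨d.swap, lt_of_le_of_ne (not_lt.mp hd.2) (hD d hd.1).symm⟩,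
        by simpa using hd.1, by simp⟩
  simp only [orientCount, Finset.sum_add_distrib]
  rw [h1, h2, Finset.card_filter_add_card_filter_not]

/-- `D` contains at most one of `(u, v)` and `(v, u)` for any `u, v`, and no `(u, u)`. -/
def IsOriented {n : ℕ} (D : Finset (Fin n × Fin n)) : Prop := ∀ d ∈ D, d.swap ∉ D

lemma IsOriented.ne {n : ℕ} {D : Finset (Fin n × Fin n)} (h : IsOriented D) :
    ∀ d ∈ D, d.1 ≠ d.2 := by
  rintro ⟨u, v⟩ hd huv
  obtain rfl : u = v := huv
  exact h _ hd hd

lemma IsOriented.orientCount_le {n : ℕ} {D : Finset (Fin n × Fin n)} (h : IsOriented D)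
    (e : Edge n) : orientCount D e ≤ 1 := by
  have := h (e.1.1, e.1.2)
  unfold orientCount
  by_cases h1 : (e.1.1, e.1.2) ∈ D
  · have h2 : (e.1.2, e.1.1) ∉ D := this h1
    simp [h2]
    split_ifs <;> simp
  · rw [if_neg h1]
    split_ifs <;> simp

lemma sum_allowedStates {n : ℕ} (D : Finset (Fin n × Fin n)) (e : Edge n) (p : ℝ) :
    ∑ x ∈ allowedStates D e, edgeWeight p x = 1 - p / 2 * orientCount D e := by
  unfold allowedStates orientCount
  rw [Finset.sum_filter]
  by_cases h1 : (e.1.1, e.1.2) ∈ D <;> by_cases h2 : (e.1.2, e.1.1) ∈ D <;>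
    simp [Fintype.sum_option, h1, h2, edgeWeight]; all_goals ring

lemma PrGnp_avoid {n : ℕ} (p : ℝ) (D : Finset (Fin n × Fin n)) :
    PrGnp n p (avoid D) = ∏ e, (1 - p / 2 * orientCount D e) := by
  classical
  simp_rw [← sum_allowedStates]
  rw [Finset.prod_univ_sum, PrGnp, prWeight]
  rw [Finset.sum_indicator_eq_sum_filter]
  apply Finset.sum_congr _ (fun _ _ => rfl)
  ext f
  simp [mem_avoid_iff, Fintype.mem_piFinset]

lemma edgeWeight_nonneg {p : ℝ} (hp : p ∈ Set.Ioc (0 : ℝ) 1) (x : Option Bool) :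
    0 ≤ edgeWeight p x := by
  have := hp.1
  have := hp.2
  cases x <;> simp only [edgeWeight] <;> linarith

lemma PrGnp_weight_nonneg {n : ℕ} {p : ℝ} (hp : p ∈ Set.Ioc (0 : ℝ) 1) (f : Config n) :
    0 ≤ ∏ e : Edge n, edgeWeight p (f e) :=
  Finset.prod_nonneg fun _ _ => edgeWeight_nonneg hp _

lemma orientCount_le_two {n : ℕ} (D : Finset (Fin n × Fin n)) (e : Edge n) :
    orientCount D e ≤ 2 := by
  unfold orientCount
  split_ifs <;> simp

lemma PrGnp_avoid_le_pow {n : ℕ} {p : ℝ} (hp : p ∈ Set.Ioc (0 : ℝ) 1)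
    {D : Finset (Fin n × Fin n)} (hD : ∀ d ∈ D, d.1 ≠ d.2) :
    PrGnp n p (avoid D) ≤ (1 - p / 2) ^ D.card := by
  rw [PrGnp_avoid, ← sum_orientCount hD, ← Finset.prod_pow_eq_pow_sum]
  have := hp.1
  have := hp.2
  apply Finset.prod_le_prod
  · intro e _
    have : (orientCount D e : ℝ) ≤ 2 := by exact_mod_cast orientCount_le_two D e
    nlinarith
  · intro e _
    have := orientCount_le_two D e
    interval_cases orientCount D e <;> norm_num
    nlinarith [sq_nonneg p]

lemma PrGnp_avoid_of_isOriented {n : ℕ} (p : ℝ) {D : Finset (Fin n × Fin n)}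
    (hD : IsOriented D) : PrGnp n p (avoid D) = (1 - p / 2) ^ D.card := by
  rw [PrGnp_avoid, ← sum_orientCount hD.ne, ← Finset.prod_pow_eq_pow_sum]
  apply Finset.prod_congr rfl
  intro e _
  have := hD.orientCount_le e
  interval_cases orientCount D e <;> norm_num

lemma PrGnp_avoid_of_symm {n : ℕ} {p : ℝ} (hp : p ≤ 1) {D : Finset (Fin n × Fin n)}
    (hD : ∀ d ∈ D, d.1 ≠ d.2) (hsymm : ∀ d ∈ D, d.swap ∈ D) :
    PrGnp n p (avoid D) = √(1 - p) ^ D.card := by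
  rw [PrGnp_avoid, ← sum_orientCount hD, ← Finset.prod_pow_eq_pow_sum]
  apply Finset.prod_congr rfl
  intro e _
  have hsw : (e.1.1, e.1.2) ∈ D ↔ (e.1.2, e.1.1) ∈ D := ⟨hsymm _, hsymm _⟩
  unfold orientCount
  by_cases h : (e.1.1, e.1.2) ∈ D
  · rw [if_pos h, if_pos (hsw.mp h), Real.sq_sqrt (by linarith)]
    norm_num
  · rw [if_neg h, if_neg (fun h' => h (hsw.mpr h'))]
    simp

/-- The edges present in a configuration. -/
def presentEdges {n : ℕ} (f : Config n) : Finset (Edge n) :=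
  Finset.univ.filter fun e => (f e).isSome

lemma edgeCount_le {n : ℕ} (f : Config n) : edgeCount f ≤ n.choose 2 := by
  rw [← card_edge]
  exact Finset.card_le_univ _

lemma card_allowedStates_filter {n : ℕ} {D : Finset (Fin n × Fin n)} (hD : IsOriented D)
    (X : Finset (Edge n)) (e : Edge n) :
    (((allowedStates D e).filter fun x => (x.isSome : Prop) ↔ e ∈ X).card : ℝ) =
      if e ∈ X then 2 * (if orientCount D e = 1 then (1 / 2 : ℝ) else 1) else 1 := by
  have h : (e.1.1, e.1.2) ∈ D → (e.1.2, e.1.1) ∉ D := fun h => hD _ h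
  unfold allowedStates orientCount
  rw [Finset.card_filter, Finset.sum_filter]
  by_cases h1 : (e.1.1, e.1.2) ∈ D <;> by_cases h2 : (e.1.2, e.1.1) ∈ D <;> by_cases h3 : e ∈ X
  on_goal 1 => exact absurd h2 (h h1)
  on_goal 1 => exact absurd h2 (h h1)
  all_goals simp [Fintype.sum_option, h1, h2, h3]
  exact_mod_cast (by decide : (Finset.univ.filter fun x : Option Bool => x.isSome = true).card = 2)

lemma card_filter_orientCount {n : ℕ} {D : Finset (Fin n × Fin n)} (hD : IsOriented D) :
    (Finset.univ.filter fun e => orientCount D e = 1).card = D.card := by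
  rw [← sum_orientCount hD.ne, Finset.card_filter]
  apply Finset.sum_congr rfl
  intro e _
  have := hD.orientCount_le e
  interval_cases orientCount D e <;> simp

lemma IsOriented.card_le {n : ℕ} {D : Finset (Fin n × Fin n)} (hD : IsOriented D) :
    D.card ≤ n.choose 2 := by
  rw [← card_filter_orientCount hD, ← card_edge]
  exact Finset.card_le_univ _

lemma sum_avoid_presentEdges {n : ℕ} {D : Finset (Fin n × Fin n)} (hD : IsOriented D)
    (X : Finset (Edge n)) :
    ∑ f : Config n with presentEdges f = X, (avoid D).indicator (fun _ => (1 : ℝ)) f =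
      2 ^ X.card *
        (1 / 2 : ℝ) ^ ((Finset.univ.filter fun e => orientCount D e = 1) ∩ X).card := by
  classical
  calc _ = ((Fintype.piFinset fun e : Edge n =>
          (allowedStates D e).filter fun x => (x.isSome : Prop) ↔ e ∈ X).card : ℝ) := by
        rw [Finset.sum_indicator_eq_sum_filter, Finset.sum_const, nsmul_eq_mul, mul_one]
        congr 2
        ext f
        simp only [Finset.mem_filter, Finset.mem_univ, true_and, Fintype.mem_piFinset,
          mem_avoid_iff, presentEdges, Finset.ext_iff, forall_and]
        exact and_comm
    _ = ∏ e : Edge n,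
          if e ∈ X then 2 * (if orientCount D e = 1 then (1 / 2 : ℝ) else 1) else 1 := by
        rw [Fintype.card_piFinset]
        push_cast
        exact Finset.prod_congr rfl fun e _ => card_allowedStates_filter hD X e
    _ = _ := by
        rw [Finset.prod_ite_mem, Finset.univ_inter, Finset.prod_mul_distrib, Finset.prod_const,
          ← Finset.prod_filter, Finset.prod_const]
        congr 3
        ext e
        simp [and_comm]

lemma PrGnm_avoid {n m : ℕ} (hm : m ≤ n.choose 2) {D : Finset (Fin n × Fin n)}
    (hD : IsOriented D) :
    PrGnm n m (avoid D) = hypergeomGF (n.choose 2) (1 / 2) D.card m := by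
  classical
  have hpos : (0 : ℝ) < ((n.choose 2).choose m : ℝ) := by exact_mod_cast Nat.choose_pos hm
  have h := sum_powersetCard_pow_card_inter (Finset.univ.filter fun e => orientCount D e = 1)
    (1 / 2) (k := m)
  rw [card_edge, card_filter_orientCount hD] at h
  apply mul_left_cancel₀ hpos.ne'
  rw [← h, PrGnm, prWeight, ← Finset.sum_fiberwise (s := Finset.univ) (g := presentEdges),
    ← Finset.powerset_univ, Finset.powersetCard_eq_filter, Finset.sum_filter, Finset.mul_sum]
  apply Finset.sum_congr rfl
  intro X _
  have hX : ∀ f ∈ Finset.univ.filter (fun f : Config n => presentEdges f = X),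
      (avoid D).indicator (fun f => if edgeCount f = m then
        (((n.choose 2).choose m : ℝ) * 2 ^ m)⁻¹ else 0) f =
      (if X.card = m then (((n.choose 2).choose m : ℝ) * 2 ^ m)⁻¹ else 0) *
        (avoid D).indicator (fun _ => (1 : ℝ)) f := by
    intro f hf
    have : edgeCount f = X.card := by rw [← (Finset.mem_filter.mp hf).2]; rfl
    by_cases hf' : f ∈ avoid D <;> simp [hf', this]
  rw [Finset.sum_congr rfl hX, ← Finset.mul_sum, sum_avoid_presentEdges hD]
  split_ifs with hXm
  · rw [hXm]
    field_simp
  · simp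

lemma prod_edgeWeight {n : ℕ} (p : ℝ) (f : Config n) :
    ∏ e, edgeWeight p (f e) = (p / 2) ^ edgeCount f * (1 - p) ^ (n.choose 2 - edgeCount f) := by
  classical
  have h : ∀ e, edgeWeight p (f e) = if (f e).isSome then p / 2 else 1 - p := by
    intro e
    cases f e <;> simp [edgeWeight]
  simp_rw [h]
  rw [Finset.prod_ite, Finset.prod_const, Finset.prod_const]
  have h2 : (Finset.univ.filter fun e : Edge n => ¬ (f e).isSome).card =
      n.choose 2 - edgeCount f := by
    rw [← card_edge, ← Finset.card_univ, edgeCount,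
      ← Finset.card_filter_add_card_filter_not (s := Finset.univ) (fun e : Edge n => (f e).isSome)]
    simp
  rw [h2]
  rfl

lemma PrGnp_inter_edgeCount {n m : ℕ} (hm : m ≤ n.choose 2) (p : ℝ) (E : Set (Config n)) :
    PrGnp n p (E ∩ {f | edgeCount f = m}) =
      ((n.choose 2).choose m : ℝ) * p ^ m * (1 - p) ^ (n.choose 2 - m) * PrGnm n m E := by
  classical
  have hpos : (0 : ℝ) < ((n.choose 2).choose m : ℝ) := by exact_mod_cast Nat.choose_pos hm
  rw [PrGnp, PrGnm, prWeight, prWeight, Finset.mul_sum]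
  apply Finset.sum_congr rfl
  intro f _
  by_cases h1 : f ∈ E <;> by_cases h2 : edgeCount f = m
  · have hmem : f ∈ E ∩ {f | edgeCount f = m} := ⟨h1, h2⟩
    rw [Set.indicator_of_mem hmem, Set.indicator_of_mem h1, if_pos h2, prod_edgeWeight, h2, div_pow]
    field_simp
  · rw [Set.indicator_of_notMem (fun h => h2 h.2), Set.indicator_of_mem h1, if_neg h2, mul_zero]
  · rw [Set.indicator_of_notMem (fun h => h1 h.1), Set.indicator_of_notMem h1, mul_zero]
  · rw [Set.indicator_of_notMem (fun h => h1 h.1), Set.indicator_of_notMem h1, mul_zero]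

lemma PrGnm_univ {n m : ℕ} (hm : m ≤ n.choose 2) : PrGnm n m Set.univ = 1 := by
  have h : (avoid ∅ : Set (Config n)) = Set.univ := by
    ext f
    simp [avoid]
  rw [← h, PrGnm_avoid hm (by simp [IsOriented]), Finset.card_empty, hypergeomGF_comm,
    hypergeomGF_zero]

lemma PrGnp_edgeCount {n m : ℕ} (hm : m ≤ n.choose 2) (p : ℝ) :
    PrGnp n p {f | edgeCount f = m} =
      ((n.choose 2).choose m : ℝ) * p ^ m * (1 - p) ^ (n.choose 2 - m) := by
  rw [← Set.univ_inter {f : Config n | edgeCount f = m}, PrGnp_inter_edgeCount hm, PrGnm_univ hm,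
    mul_one]

lemma sum_PrGnp_edgeCount_mul_PrGnm (n : ℕ) (p : ℝ) (E : Set (Config n)) :
    ∑ m ∈ Finset.range (n.choose 2 + 1), PrGnp n p {f | edgeCount f = m} * PrGnm n m E =
      PrGnp n p E := by
  classical
  have h : ∀ m ∈ Finset.range (n.choose 2 + 1),
      PrGnp n p {f | edgeCount f = m} * PrGnm n m E =
        PrGnp n p (E ∩ {f | edgeCount f = m}) := by
    intro m hm
    have hm' : m ≤ n.choose 2 := Nat.lt_succ_iff.mp (Finset.mem_range.mp hm)
    rw [PrGnp_edgeCount hm', PrGnp_inter_edgeCount hm']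
  rw [Finset.sum_congr rfl h]
  simp only [PrGnp, prWeight]
  rw [Finset.sum_comm]
  apply Finset.sum_congr rfl
  intro f _
  rw [Finset.sum_eq_single (edgeCount f)]
  · by_cases hf : f ∈ E
    · have hmem : f ∈ E ∩ {g | edgeCount g = edgeCount f} := ⟨hf, rfl⟩
      rw [Set.indicator_of_mem hmem, Set.indicator_of_mem hf]
    · rw [Set.indicator_of_notMem (fun h => hf h.1), Set.indicator_of_notMem hf]
  · intro m _ hm
    exact Set.indicator_of_notMem (fun h => hm h.2.symm) _
  · intro hf
    exact absurd (Finset.mem_range.mpr (Nat.lt_succ_of_le (edgeCount_le f))) hf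

lemma PrGnm_weight_nonneg {n : ℕ} (m : ℕ) (f : Config n) :
    0 ≤ if edgeCount f = m then (((n.choose 2).choose m : ℝ) * 2 ^ m)⁻¹ else 0 := by
  split_ifs <;> positivity

/-- The pairs leaving `S`: the configurations in `avoid (cut S)` are those in which `S` is closed
under directed edges. -/
def cut {n : ℕ} (S : Finset (Fin n)) : Finset (Fin n × Fin n) := S ×ˢ Sᶜ

lemma mem_avoid_cut {n : ℕ} {S : Finset (Fin n)} {f : Config n} :
    f ∈ avoid (cut S) ↔ ∀ u ∈ S, ∀ v, DirEdge f u v → v ∈ S := by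
  simp only [avoid, cut, Set.mem_ofPred_eq, Finset.mem_product, Finset.mem_compl, Prod.forall]
  constructor
  · intro h u hu v huv
    by_contra hv
    exact h u v ⟨hu, hv⟩ huv
  · intro h u v huv hd
    exact huv.2 (h u huv.1 v hd)

lemma avoid_cut_inter {n : ℕ} {S T : Finset (Fin n)} {f : Config n} (hS : f ∈ avoid (cut S))
    (hT : f ∈ avoid (cut T)) : f ∈ avoid (cut (S ∩ T)) := by
  rw [mem_avoid_cut] at *
  intro u hu v huv
  rw [Finset.mem_inter] at *
  exact ⟨hS u hu.1 v huv, hT u hu.2 v huv⟩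

lemma avoid_cut_union {n : ℕ} {S T : Finset (Fin n)} {f : Config n} (hS : f ∈ avoid (cut S))
    (hT : f ∈ avoid (cut T)) : f ∈ avoid (cut (S ∪ T)) := by
  rw [mem_avoid_cut] at *
  intro u hu v huv
  rw [Finset.mem_union] at *
  exact hu.imp (fun h => hS u h v huv) (fun h => hT u h v huv)

lemma not_reaches_of_mem_avoid_cut {n : ℕ} {S : Finset (Fin n)} {f : Config n}
    (hf : f ∈ avoid (cut S)) {x y : Fin n} (hx : x ∈ S) (hy : y ∉ S) : ¬ Reaches f x y := by
  intro h
  rw [mem_avoid_cut] at hf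
  refine hy ?_
  clear hy
  induction h with
  | refl => exact hx
  | tail _ h ih => exact hf _ ih _ h

lemma exists_mem_avoid_cut {n : ℕ} {f : Config n} {x y : Fin n} (h : ¬ Reaches f x y) :
    ∃ S : Finset (Fin n), x ∈ S ∧ y ∉ S ∧ f ∈ avoid (cut S) := by
  classical
  refine ⟨Finset.univ.filter fun v => Reaches f x v, ?_, ?_, ?_⟩
  · exact Finset.mem_filter.mpr ⟨Finset.mem_univ x, Relation.ReflTransGen.refl⟩
  · simpa using h
  · rw [mem_avoid_cut]
    intro u hu v huv
    simp only [Finset.mem_filter, Finset.mem_univ, true_and] at *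
    exact Relation.ReflTransGen.tail hu huv

lemma isOriented_cut_union {n : ℕ} {S T : Finset (Fin n)} (h : S ⊆ T) :
    IsOriented (cut S ∪ cut T) := by
  rintro ⟨u, v⟩ hd hd'
  simp only [cut, Finset.mem_union, Finset.mem_product, Finset.mem_compl, Prod.swap] at hd hd'
  have hu := @h u
  have hv := @h v
  tauto

lemma card_cut {n : ℕ} (S : Finset (Fin n)) : (cut S).card = S.card * (n - S.card) := by
  rw [cut, Finset.card_product, Finset.card_compl, Fintype.card_fin]

lemma isOriented_cut {n : ℕ} (S : Finset (Fin n)) : IsOriented (cut S) := by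
  simpa using isOriented_cut_union (Finset.Subset.refl S)

lemma card_cut_union {n : ℕ} {S T : Finset (Fin n)} (h : S ⊆ T) :
    (cut S ∪ cut T).card = S.card * (n - S.card) + (T.card - S.card) * (n - T.card) := by
  have h1 : cut S ∪ cut T = cut S ∪ (T \ S) ×ˢ Tᶜ := by
    ext ⟨u, v⟩
    simp only [cut, Finset.mem_union, Finset.mem_product, Finset.mem_compl, Finset.mem_sdiff]
    have hu := @h u
    have hv := @h v
    tauto
  rw [h1, Finset.card_union_of_disjoint, card_cut, Finset.card_product,
    Finset.card_sdiff_of_subset h, Finset.card_compl, Fintype.card_fin]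
  rw [Finset.disjoint_left]
  rintro ⟨u, v⟩ h2 h3
  simp only [cut, Finset.mem_product, Finset.mem_sdiff] at h2 h3
  exact h3.1.2 h2.1

lemma exists_eq_pair_of_card_le_two {α : Type*} [DecidableEq α] {S : Finset α} {x : α}
    (hx : x ∈ S) (hS : S.card ≤ 2) : ∃ y, S = {x, y} := by
  by_cases h : ∃ y ∈ S, y ≠ x
  · obtain ⟨y, hy, hyx⟩ := h
    refine ⟨y, (Finset.eq_of_subset_of_card_le ?_ ?_).symm⟩
    · intro z hz
      rw [Finset.mem_insert, Finset.mem_singleton] at hz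
      rcases hz with rfl | rfl <;> assumption
    · rwa [Finset.card_pair hyx.symm]
  · push Not at h
    refine ⟨x, ?_⟩
    ext z
    rw [Finset.pair_eq_singleton, Finset.mem_singleton]
    exact ⟨h z, fun hz => hz ▸ hx⟩

/-- Index set of the error terms in the approximation of `ℙ(x ↛ y)`. -/
def errorIndex (n : ℕ) : Finset (Option (Finset (Fin n))) :=
  Finset.insertNone (Finset.univ.filter fun S => 2 ≤ S.card ∧ S.card ≤ n - 2)

/-- The number of forbidden edges in an error term. -/
def errorSize (n : ℕ) : Option (Finset (Fin n)) → ℕ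
  | none => 2 * n - 3
  | some S => S.card * (n - S.card)

lemma two_mul_sub_le_mul {n k : ℕ} (h2 : 2 ≤ k) (hk : k ≤ n - 2) :
    2 * (n - 2) ≤ k * (n - k) := by
  obtain ⟨i, rfl⟩ := Nat.exists_eq_add_of_le h2
  obtain ⟨j, hj⟩ := Nat.exists_eq_add_of_le hk
  obtain rfl : n = 4 + i + j := by omega
  rw [show 4 + i + j - 2 = 2 + i + j by omega, show 4 + i + j - (2 + i) = 2 + j by omega]
  nlinarith [Nat.zero_le (i * j)]

lemma le_errorSize {n : ℕ} {i : Option (Finset (Fin n))} (hi : i ∈ errorIndex n) :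
    2 * (n - 2) ≤ errorSize n i := by
  cases i with
  | none => simp only [errorSize]; omega
  | some S =>
    simp only [errorIndex, Finset.some_mem_insertNone, Finset.mem_filter, Finset.mem_univ,
      true_and] at hi
    exact two_mul_sub_le_mul hi.1 hi.2

lemma cut_union_singleton_card {n : ℕ} (hn : 3 ≤ n) {x y : Fin n} (h : x ≠ y) :
    (cut {x} ∪ cut {y}ᶜ).card = 2 * n - 3 := by
  rw [card_cut_union (by simpa using h.symm), Finset.card_compl, Finset.card_singleton,
    Finset.card_singleton, Fintype.card_fin, show n - (n - 1) = 1 by omega]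
  omega

lemma errorSize_le {n : ℕ} (hn : 3 ≤ n) (i : Option (Finset (Fin n))) :
    errorSize n i ≤ n.choose 2 := by
  cases i with
  | none =>
    have hxy : (⟨0, by omega⟩ : Fin n) ≠ ⟨1, by omega⟩ := by simp
    rw [errorSize, ← cut_union_singleton_card hn hxy]
    exact (isOriented_cut_union (by simp)).card_le
  | some S =>
    rw [errorSize, ← card_cut]
    exact (isOriented_cut S).card_le

lemma setOf_not_reaches_subset {n : ℕ} {x y : Fin n} :
    {f : Config n | ¬ Reaches f x y} ⊆ (avoid (cut {x}) ∪ avoid (cut {y}ᶜ)) ∪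
      ⋃ S ∈ Finset.univ.filter fun S : Finset (Fin n) => 2 ≤ S.card ∧ S.card ≤ n - 2,
        avoid (cut S) := by
  intro f hf
  obtain ⟨S, hx, hy, hS⟩ := exists_mem_avoid_cut hf
  by_cases h1 : S.card ≤ 1
  · have : S = {x} := by
      rw [Finset.card_le_one] at h1
      ext z
      rw [Finset.mem_singleton]
      exact ⟨fun hz => h1 z hz x hx, fun hz => hz ▸ hx⟩
    exact Or.inl (Or.inl (this ▸ hS))
  by_cases h2 : n - 1 ≤ S.card
  · have : S = {y}ᶜ := by
      apply Finset.eq_of_subset_of_card_le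
      · simpa using hy
      · rwa [Finset.card_compl, Finset.card_singleton, Fintype.card_fin]
    exact Or.inl (Or.inr (this ▸ hS))
  · refine Or.inr (Set.mem_biUnion (x := S) ?_ hS)
    simp only [Finset.coe_filter, Finset.mem_univ, true_and, Set.mem_ofPred_eq]
    omega

lemma avoid_cut_union_subset {n : ℕ} {x y : Fin n} (h : x ≠ y) :
    avoid (cut {x}) ∪ avoid (cut {y}ᶜ) ⊆ {f : Config n | ¬ Reaches f x y} := by
  rintro f (hf | hf)
  · exact not_reaches_of_mem_avoid_cut hf (by simp) (by simpa using h.symm)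
  · exact not_reaches_of_mem_avoid_cut hf (by simpa using h) (by simp)

/-- Up to small terms, `x ↛ y` only if `x` has out-degree `0` or `y` has in-degree `0`. -/
lemma abs_PrGnm_not_reaches_sub_le {n m : ℕ} (hn : 3 ≤ n) (hm : m ≤ n.choose 2) {x y : Fin n}
    (h : x ≠ y) :
    |PrGnm n m {f | ¬ Reaches f x y} - 2 * hypergeomGF (n.choose 2) (1 / 2) (n - 1) m| ≤
      ∑ i ∈ errorIndex n, hypergeomGF (n.choose 2) (1 / 2) (errorSize n i) m := by
  have hw := PrGnm_weight_nonneg (n := n) m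
  have hx : PrGnm n m (avoid (cut {x})) = hypergeomGF (n.choose 2) (1 / 2) (n - 1) m := by
    rw [PrGnm_avoid hm (isOriented_cut _), card_cut, Finset.card_singleton, one_mul]
  have hy : PrGnm n m (avoid (cut {y}ᶜ)) = hypergeomGF (n.choose 2) (1 / 2) (n - 1) m := by
    rw [PrGnm_avoid hm (isOriented_cut _), card_cut, Finset.card_compl, Finset.card_singleton,
      Fintype.card_fin, show n - (n - 1) = 1 by omega, mul_one]
  have hxy : PrGnm n m (avoid (cut {x}) ∩ avoid (cut {y}ᶜ)) =
      hypergeomGF (n.choose 2) (1 / 2) (2 * n - 3) m := by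
    rw [← avoid_union, PrGnm_avoid hm (isOriented_cut_union (by simpa using h.symm)),
      cut_union_singleton_card hn h]
  have hcut : ∀ S : Finset (Fin n), PrGnm n m (avoid (cut S)) =
      hypergeomGF (n.choose 2) (1 / 2) (S.card * (n - S.card)) m := by
    intro S
    rw [PrGnm_avoid hm (isOriented_cut _), card_cut]
  have hie : PrGnm n m (avoid (cut {x}) ∪ avoid (cut {y}ᶜ)) +
      PrGnm n m (avoid (cut {x}) ∩ avoid (cut {y}ᶜ)) = _ := prWeight_union_add_inter _ _
  have hle : PrGnm n m (avoid (cut {x}) ∪ avoid (cut {y}ᶜ)) ≤ _ :=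
    prWeight_mono hw (avoid_cut_union_subset h)
  have hge : PrGnm n m {f | ¬ Reaches f x y} ≤ _ :=
    (prWeight_mono hw setOf_not_reaches_subset).trans
      ((prWeight_union_le hw _ _).trans
        (add_le_add (le_refl _) (prWeight_biUnion_le hw _ _)))
  change PrGnm n m {f | ¬ Reaches f x y} ≤ PrGnm n m (avoid (cut {x}) ∪ avoid (cut {y}ᶜ)) +
    ∑ S ∈ Finset.univ.filter (fun S : Finset (Fin n) => 2 ≤ S.card ∧ S.card ≤ n - 2),
      PrGnm n m (avoid (cut S)) at hge
  change PrGnm n m (avoid (cut {x}) ∪ avoid (cut {y}ᶜ)) ≤ PrGnm n m {f | ¬ Reaches f x y} at hle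
  change PrGnm n m (avoid (cut {x}) ∪ avoid (cut {y}ᶜ)) +
      PrGnm n m (avoid (cut {x}) ∩ avoid (cut {y}ᶜ)) =
      PrGnm n m (avoid (cut {x})) + PrGnm n m (avoid (cut {y}ᶜ)) at hie
  have hnn : 0 ≤ PrGnm n m (avoid (cut {x}) ∩ avoid (cut {y}ᶜ)) := prWeight_nonneg hw _
  have hS : 0 ≤ ∑ S ∈ Finset.univ.filter (fun S : Finset (Fin n) => 2 ≤ S.card ∧ S.card ≤ n - 2),
      PrGnm n m (avoid (cut S)) := Finset.sum_nonneg fun S _ => prWeight_nonneg hw _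
  rw [errorIndex, Finset.sum_insertNone]
  simp only [errorSize, ← hcut]
  rw [← hxy, abs_le]
  constructor <;> linarith

section JointEvent

variable {n : ℕ}

/-- The vertices other than `x`, `y`, `z`, `w`. -/
def otherVertices (x y z w : Fin n) : Finset (Fin n) := ({x, y, z, w} : Finset (Fin n))ᶜ

lemma le_card_otherVertices (x y z w : Fin n) : n - 4 ≤ (otherVertices x y z w).card := by
  rw [otherVertices, Finset.card_compl, Fintype.card_fin]
  have : ({x, y, z, w} : Finset (Fin n)).card ≤ 4 := Finset.card_le_four
  omega

/-- The pairs leading from `{a, x}` to other vertices or from those to `b`. -/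
def outPairCut (a x b y : Fin n) : Finset (Fin n × Fin n) :=
  {a, x} ×ˢ otherVertices a x b y ∪ otherVertices a x b y ×ˢ {b}

/-- The pairs leading from `a` to other vertices or from those to `{b, y}`. -/
def inPairCut (a x b y : Fin n) : Finset (Fin n × Fin n) :=
  {a} ×ˢ otherVertices a x b y ∪ otherVertices a x b y ×ˢ {b, y}

/-- All pairs formed by `s` and a vertex other than `s`, `x`, `y`. -/
def isolationCut (s x y : Fin n) : Finset (Fin n × Fin n) :=
  {s} ×ˢ otherVertices s x y y ∪ otherVertices s x y y ×ˢ {s}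

lemma card_product_union_product {S W T : Finset (Fin n)} (hS : Disjoint S W) :
    (S ×ˢ W ∪ W ×ˢ T).card = (S.card + T.card) * W.card := by
  rw [Finset.card_union_of_disjoint, Finset.card_product, Finset.card_product]
  · ring
  · rw [Finset.disjoint_left]
    rintro ⟨u, v⟩ h1 h2
    rw [Finset.mem_product] at h1 h2
    exact Finset.disjoint_left.mp hS h1.1 h2.1

lemma ne_of_mem_product_union_product {S W T : Finset (Fin n)} (hS : Disjoint S W)
    (hT : Disjoint W T) : ∀ d ∈ S ×ˢ W ∪ W ×ˢ T, d.1 ≠ d.2 := by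
  rintro ⟨u, v⟩ h huv
  obtain rfl : u = v := huv
  rw [Finset.mem_union, Finset.mem_product, Finset.mem_product] at h
  rcases h with h | h
  · exact Finset.disjoint_left.mp hS h.1 h.2
  · exact Finset.disjoint_left.mp hT h.1 h.2

lemma disjoint_otherVertices {S : Finset (Fin n)} {x y z w : Fin n} (h : S ⊆ {x, y, z, w}) :
    Disjoint S (otherVertices x y z w) :=
  Finset.disjoint_left.mpr fun _ hv hv' => Finset.mem_compl.mp hv' (h hv)

variable {p : ℝ}

lemma PrGnp_avoid_product_le (hp : p ∈ Set.Ioc (0 : ℝ) 1) {S T : Finset (Fin n)} {x y z w : Fin n}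
    (hS : S ⊆ {x, y, z, w}) (hT : T ⊆ {x, y, z, w}) (hST : S.card + T.card = 3) :
    PrGnp n p (avoid (S ×ˢ otherVertices x y z w ∪ otherVertices x y z w ×ˢ T)) ≤
      (1 - p / 2) ^ (3 * (n - 4)) := by
  have h1 := disjoint_otherVertices hS
  have h2 := disjoint_otherVertices hT
  have hp1 := hp.1
  have hp2 := hp.2
  refine (PrGnp_avoid_le_pow hp (ne_of_mem_product_union_product h1 h2.symm)).trans ?_
  rw [card_product_union_product h1, hST]
  exact pow_le_pow_of_le_one (by linarith) (by linarith)
    (Nat.mul_le_mul_left 3 (le_card_otherVertices x y z w))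

lemma PrGnp_avoid_outPairCut_le (hp : p ∈ Set.Ioc (0 : ℝ) 1) {a x : Fin n} (b y : Fin n)
    (h : a ≠ x) : PrGnp n p (avoid (outPairCut a x b y)) ≤ (1 - p / 2) ^ (3 * (n - 4)) := by
  apply PrGnp_avoid_product_le hp
  · intro v; simp; tauto
  · intro v; simp; tauto
  · rw [Finset.card_pair h, Finset.card_singleton]

lemma PrGnp_avoid_inPairCut_le (hp : p ∈ Set.Ioc (0 : ℝ) 1) {b y : Fin n} (a x : Fin n)
    (h : b ≠ y) : PrGnp n p (avoid (inPairCut a x b y)) ≤ (1 - p / 2) ^ (3 * (n - 4)) := by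
  apply PrGnp_avoid_product_le hp
  · intro v; simp; tauto
  · intro v; simp; tauto
  · rw [Finset.card_pair h, Finset.card_singleton]

lemma PrGnp_avoid_isolationCut_le (hp : p ∈ Set.Ioc (0 : ℝ) 1) (s x y : Fin n) :
    PrGnp n p (avoid (isolationCut s x y)) ≤ (1 - p) ^ (n - 4) := by
  have h1 : Disjoint {s} (otherVertices s x y y) := disjoint_otherVertices (by simp)
  rw [isolationCut, PrGnp_avoid_of_symm hp.2 (ne_of_mem_product_union_product h1 h1.symm),
    card_product_union_product h1, Finset.card_singleton, pow_mul,
    Real.sq_sqrt (by linarith [hp.2])]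
  · exact pow_le_pow_of_le_one (by linarith [hp.2]) (by linarith [hp.1])
      (le_card_otherVertices s x y y)
  · rintro ⟨u, v⟩ h
    simp only [Finset.mem_union, Finset.mem_product, Prod.swap] at *
    tauto

lemma mem_avoid_product_union_product {S T U W : Finset (Fin n)} {f : Config n}
    (hS : f ∈ avoid (cut S)) (hT : f ∈ avoid (cut T)) (hSW : Disjoint S W) (hWT : W ⊆ T)
    (hU : Disjoint T U) : f ∈ avoid (S ×ˢ W ∪ W ×ˢ U) := by
  rintro ⟨u, v⟩ h huv
  rw [mem_avoid_cut] at hS hT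
  rw [Finset.mem_union, Finset.mem_product, Finset.mem_product] at h
  rcases h with h | h
  · exact Finset.disjoint_left.mp hSW (hS u h.1 v huv) h.2
  · exact Finset.disjoint_left.mp hU (hT u (hWT h.1) v huv) h.2

lemma mem_avoid_outPairCut {a x b y : Fin n} {T : Finset (Fin n)} {f : Config n}
    (hS : f ∈ avoid (cut {a, x})) (hT : f ∈ avoid (cut T)) (hb : b ∉ T) (hy : Tᶜ ⊆ {b, y}) :
    f ∈ avoid (outPairCut a x b y) := by
  refine mem_avoid_product_union_product hS hT (disjoint_otherVertices ?_) ?_ (by simpa using hb)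
  · intro v; simp; tauto
  · intro v hv
    by_contra hvT
    have := hy (Finset.mem_compl.mpr hvT)
    simp only [otherVertices, Finset.mem_compl, Finset.mem_insert, Finset.mem_singleton] at hv this
    tauto

lemma mem_avoid_inPairCut {a x b y : Fin n} {S : Finset (Fin n)} {f : Config n}
    (hS : f ∈ avoid (cut S)) (hT : f ∈ avoid (cut {b, y}ᶜ)) (ha : a ∈ S) (hx : S ⊆ {a, x}) :
    f ∈ avoid (inPairCut a x b y) := by
  have h : f ∈ avoid (S ×ˢ otherVertices a x b y ∪ otherVertices a x b y ×ˢ {b, y}) := by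
    refine mem_avoid_product_union_product hS hT (disjoint_otherVertices ?_) ?_ ?_
    · intro v hv
      have := hx hv
      simp only [Finset.mem_insert, Finset.mem_singleton] at *
      tauto
    · intro v
      simp only [otherVertices, Finset.mem_compl, Finset.mem_insert, Finset.mem_singleton]
      tauto
    · exact disjoint_compl_left
  refine avoid_anti (Finset.union_subset_union ?_ (Finset.Subset.refl _)) h
  exact Finset.product_subset_product (by simpa using ha) (Finset.Subset.refl _)

/-- If only sets of size at most two and their complements can be closed, then `a ↛ s` and `s ↛ b`
can occur together only in one of six ways. -/
lemma mem_avoid_of_not_reaches {s a b : Fin n} (hn : 7 ≤ n) (hsa : s ≠ a) (hsb : s ≠ b)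
    {f : Config n} (h1 : ¬ Reaches f a s) (h2 : ¬ Reaches f s b)
    (hf : ∀ S : Finset (Fin n), f ∈ avoid (cut S) → S.card ≤ 2 ∨ Sᶜ.card ≤ 2) :
    f ∈ avoid (cut {a} ∪ cut {a, s}) ∨ f ∈ avoid (cut {a} ∪ cut {b}ᶜ) ∨
      f ∈ avoid (cut {b, s}ᶜ ∪ cut {b}ᶜ) ∨
      (∃ x y, a ≠ x ∧ f ∈ avoid (outPairCut a x b y)) ∨
      (∃ x y, b ≠ y ∧ f ∈ avoid (inPairCut a x b y)) ∨
      ∃ x y, f ∈ avoid (isolationCut s x y) := by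
  obtain ⟨S, haS, hsS, hS⟩ := exists_mem_avoid_cut h1
  obtain ⟨T, hsT, hbT, hT⟩ := exists_mem_avoid_cut h2
  have hun := avoid_cut_union hS hT
  have hin := avoid_cut_inter hS hT
  have hSc : s ∈ Sᶜ := Finset.mem_compl.mpr hsS
  have hTc : b ∈ Tᶜ := Finset.mem_compl.mpr hbT
  have hcompl : ∀ U : Finset (Fin n), U.card + Uᶜ.card = n := fun U => by
    rw [Finset.card_add_card_compl, Fintype.card_fin]
  rcases hf S hS with hS2 | hS2 <;> rcases hf T hT with hT2 | hT2
  · left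
    have h4 := Finset.card_union_le S T
    have h5 : (S ∪ T).card ≤ 2 := by
      rcases hf _ hun with h | h
      · exact h
      · have := hcompl (S ∪ T)
        omega
    have h6 : S ∪ T = {a, s} := by
      symm
      apply Finset.eq_of_subset_of_card_le
      · intro v hv
        rw [Finset.mem_insert, Finset.mem_singleton] at hv
        rw [Finset.mem_union]
        rcases hv with rfl | rfl
        exacts [Or.inl haS, Or.inr hsT]
      · rwa [Finset.card_pair hsa.symm]
    have h7 : S = {a} := by
      ext v
      rw [Finset.mem_singleton]
      constructor
      · intro hv
        have : v ∈ ({a, s} : Finset (Fin n)) := h6 ▸ Finset.mem_union_left T hv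
        rw [Finset.mem_insert, Finset.mem_singleton] at this
        rcases this with h | rfl
        exacts [h, absurd hv hsS]
      · rintro rfl
        exact haS
    rw [avoid_union, ← h6, ← h7]
    exact ⟨hS, hun⟩
  · right
    obtain ⟨x, hx⟩ := exists_eq_pair_of_card_le_two haS hS2
    obtain ⟨y, hy⟩ := exists_eq_pair_of_card_le_two hTc hT2
    have hTy : T = {b, y}ᶜ := by rw [← hy, compl_compl]
    by_cases hax : a = x
    · by_cases hby : b = y
      · left
        subst hax hby
        rw [Finset.pair_eq_singleton] at hx hTy
        rw [avoid_union, ← hx, ← hTy]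
        exact ⟨hS, hT⟩
      · right; right; right; left
        exact ⟨x, y, hby, mem_avoid_inPairCut hS (hTy ▸ hT) haS hx.le⟩
    · right; right; left
      exact ⟨x, y, hax, mem_avoid_outPairCut (hx ▸ hS) hT hbT hy.le⟩
  · right; right; right; right; right
    obtain ⟨x, hx⟩ := exists_eq_pair_of_card_le_two hSc hS2
    obtain ⟨y, hy⟩ := exists_eq_pair_of_card_le_two hsT hT2
    refine ⟨x, y, ?_⟩
    rintro ⟨u, v⟩ h huv
    rw [mem_avoid_cut] at hS hT
    simp only [isolationCut, Finset.mem_union, Finset.mem_product, Finset.mem_singleton,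
      otherVertices, Finset.mem_compl, Finset.mem_insert, not_or] at h
    rcases h with ⟨rfl, h⟩ | ⟨h, rfl⟩
    · have hv := hT u hsT v huv
      rw [hy, Finset.mem_insert, Finset.mem_singleton] at hv
      tauto
    · refine hsS (hS u ?_ v huv)
      by_contra hu
      have hu' := Finset.mem_compl.mpr hu
      rw [hx, Finset.mem_insert, Finset.mem_singleton] at hu'
      tauto
  · right; right; left
    have h4 := Finset.card_union_le Sᶜ Tᶜ
    rw [← Finset.compl_inter] at h4
    have h5 : (S ∩ T)ᶜ.card ≤ 2 := by
      rcases hf _ hin with h | h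
      · have := hcompl (S ∩ T)
        omega
      · exact h
    have h6 : (S ∩ T)ᶜ = {b, s} := by
      symm
      apply Finset.eq_of_subset_of_card_le
      · intro v hv
        rw [Finset.mem_insert, Finset.mem_singleton] at hv
        rw [Finset.compl_inter, Finset.mem_union]
        rcases hv with rfl | rfl
        exacts [Or.inr hTc, Or.inl hSc]
      · rwa [Finset.card_pair hsb.symm]
    have h7 : T = {b}ᶜ := by
      ext v
      rw [Finset.mem_compl, Finset.mem_singleton]
      constructor
      · rintro hv rfl
        exact hbT hv
      · intro hv
        by_contra hvT
        have : v ∈ ({b, s} : Finset (Fin n)) := by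
          rw [← h6, Finset.compl_inter, Finset.mem_union]
          exact Or.inr (Finset.mem_compl.mpr hvT)
        rw [Finset.mem_insert, Finset.mem_singleton] at this
        rcases this with h | rfl
        exacts [hv h, hvT hsT]
    rw [avoid_union, ← h6, ← h7, compl_compl]
    exact ⟨hin, hT⟩

end JointEvent

section JointEventBounds

variable {n : ℕ} {p : ℝ}

lemma PrGnp_avoid_cut_union (p : ℝ) {S T : Finset (Fin n)} (h : S ⊆ T) :
    PrGnp n p (avoid (cut S ∪ cut T)) =
      (1 - p / 2) ^ (S.card * (n - S.card) + (T.card - S.card) * (n - T.card)) := by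
  rw [PrGnp_avoid_of_isOriented p (isOriented_cut_union h), card_cut_union h]

/-- The error made by counting only the three main ways in which `a ↛ s` and `s ↛ b` both occur. -/
noncomputable def jointError (n : ℕ) (p : ℝ) : ℝ :=
  ∑ S : Finset (Fin n) with 3 ≤ S.card ∧ S.card ≤ n - 3, (1 - p / 2) ^ (S.card * (n - S.card)) +
    (2 * n ^ 2 + 3) * (1 - p / 2) ^ (3 * (n - 4)) + n ^ 2 * (1 - p) ^ (n - 4)

lemma PrGnp_iUnion_le (hp : p ∈ Set.Ioc (0 : ℝ) 1) (P : Fin n × Fin n → Prop)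
    (E : Fin n × Fin n → Set (Config n)) {c : ℝ} (hc : 0 ≤ c)
    (hE : ∀ d, P d → PrGnp n p (E d) ≤ c) :
    PrGnp n p {f | ∃ d, P d ∧ f ∈ E d} ≤ n ^ 2 * c := by
  classical
  have h : {f | ∃ d, P d ∧ f ∈ E d} = ⋃ d ∈ Finset.univ.filter P, E d := by
    ext f
    simp
  rw [h]
  refine (prWeight_biUnion_le (PrGnp_weight_nonneg hp) _ _).trans
    ((Finset.sum_le_card_nsmul _ _ c fun d hd => hE d (Finset.mem_filter.mp hd).2).trans ?_)
  rw [nsmul_eq_mul]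
  refine mul_le_mul_of_nonneg_right ?_ hc
  have := Finset.card_le_univ (Finset.univ.filter P)
  rw [Fintype.card_prod, Fintype.card_fin, ← sq] at this
  exact_mod_cast this

lemma abs_PrGnp_not_reaches_inter_sub_le (hp : p ∈ Set.Ioc (0 : ℝ) 1) (hn : 7 ≤ n)
    {s a b : Fin n} (hsa : s ≠ a) (hsb : s ≠ b) (hab : a ≠ b) :
    |PrGnp n p ({f | ¬ Reaches f a s} ∩ {f | ¬ Reaches f s b}) - 3 * (1 - p / 2) ^ (2 * n - 3)| ≤
      jointError n p := by
  have hp1 := hp.1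
  have hp2 := hp.2
  have hw := PrGnp_weight_nonneg (n := n) hp
  set E₁ := avoid (cut {a} ∪ cut {a, s}) with hE₁
  set E₂ := avoid (cut {a} ∪ cut {b}ᶜ) with hE₂
  set E₃ := avoid (cut {b, s}ᶜ ∪ cut {b}ᶜ) with hE₃
  have h₁ : PrGnp n p E₁ = (1 - p / 2) ^ (2 * n - 3) := by
    rw [hE₁, PrGnp_avoid_cut_union p (by simp), Finset.card_singleton, Finset.card_pair hsa.symm]
    congr 1; omega
  have h₂ : PrGnp n p E₂ = (1 - p / 2) ^ (2 * n - 3) := by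
    rw [hE₂, PrGnp_avoid_cut_union p (by simpa using hab.symm), Finset.card_compl,
      Finset.card_singleton, Finset.card_singleton, Fintype.card_fin,
      show n - (n - 1) = 1 by omega]
    congr 1; omega
  have h₃ : PrGnp n p E₃ = (1 - p / 2) ^ (2 * n - 3) := by
    rw [hE₃, PrGnp_avoid_cut_union p (Finset.compl_subset_compl.mpr (by simp)), Finset.card_compl,
      Finset.card_compl, Finset.card_pair hsb.symm, Finset.card_singleton, Fintype.card_fin,
      show n - (n - 1) = 1 by omega, show n - (n - 2) = 2 by omega]
    congr 1; omega
  have h₁₂ : E₁ ∩ E₂ ⊆ avoid (outPairCut a s b b) := by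
    rw [hE₁, hE₂, avoid_union, avoid_union]
    exact fun f hf => mem_avoid_outPairCut hf.1.2 hf.2.2 (by simp) (by simp)
  have h₁₃ : E₁ ∩ E₃ ⊆ avoid (outPairCut a s b b) := by
    rw [hE₁, hE₃, avoid_union, avoid_union]
    exact fun f hf => mem_avoid_outPairCut hf.1.2 hf.2.2 (by simp) (by simp)
  have h₂₃ : E₂ ∩ E₃ ⊆ avoid (inPairCut a a b s) := by
    rw [hE₂, hE₃, avoid_union, avoid_union]
    exact fun f hf => mem_avoid_inPairCut hf.1.1 hf.2.1 (by simp) (by simp)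
  have hout : PrGnp n p (avoid (outPairCut a s b b)) ≤ (1 - p / 2) ^ (3 * (n - 4)) :=
    PrGnp_avoid_outPairCut_le hp b b hsa.symm
  have hin : PrGnp n p (avoid (inPairCut a a b s)) ≤ (1 - p / 2) ^ (3 * (n - 4)) :=
    PrGnp_avoid_inPairCut_le hp a a hsb.symm
  have hsub : E₁ ∪ E₂ ∪ E₃ ⊆ {f | ¬ Reaches f a s} ∩ {f | ¬ Reaches f s b} := by
    rw [hE₁, hE₂, hE₃, avoid_union, avoid_union, avoid_union]
    rintro f ((hf | hf) | hf)
    · exact ⟨not_reaches_of_mem_avoid_cut hf.1 (by simp) (by simpa using hsa),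
        not_reaches_of_mem_avoid_cut hf.2 (by simp) (by simp [hab.symm, hsb.symm])⟩
    · exact ⟨not_reaches_of_mem_avoid_cut hf.1 (by simp) (by simpa using hsa),
        not_reaches_of_mem_avoid_cut hf.2 (by simpa using hsb) (by simp)⟩
    · exact ⟨not_reaches_of_mem_avoid_cut hf.1 (by simp [hab, hsa.symm]) (by simp),
        not_reaches_of_mem_avoid_cut hf.2 (by simpa using hsb) (by simp)⟩
  set U := {f : Config n | ∃ d : Fin n × Fin n, a ≠ d.1 ∧ f ∈ avoid (outPairCut a d.1 b d.2)}
  set V := {f : Config n | ∃ d : Fin n × Fin n, b ≠ d.2 ∧ f ∈ avoid (inPairCut a d.1 b d.2)}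
  set W := {f : Config n | ∃ d : Fin n × Fin n, True ∧ f ∈ avoid (isolationCut s d.1 d.2)}
  set Z : Set (Config n) := ⋃ S ∈ Finset.univ.filter (fun S : Finset (Fin n) =>
    3 ≤ S.card ∧ S.card ≤ n - 3), avoid (cut S) with hZ
  have hU : PrGnp n p U ≤ n ^ 2 * (1 - p / 2) ^ (3 * (n - 4)) :=
    PrGnp_iUnion_le hp _ _ (pow_nonneg (by linarith) _)
      fun d hd => PrGnp_avoid_outPairCut_le hp b d.2 hd
  have hV : PrGnp n p V ≤ n ^ 2 * (1 - p / 2) ^ (3 * (n - 4)) :=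
    PrGnp_iUnion_le hp _ _ (pow_nonneg (by linarith) _)
      fun d hd => PrGnp_avoid_inPairCut_le hp a d.1 hd
  have hW : PrGnp n p W ≤ n ^ 2 * (1 - p) ^ (n - 4) :=
    PrGnp_iUnion_le hp _ _ (pow_nonneg (by linarith) _)
      fun d _ => PrGnp_avoid_isolationCut_le hp s d.1 d.2
  have hZ' : PrGnp n p Z ≤ ∑ S : Finset (Fin n) with 3 ≤ S.card ∧ S.card ≤ n - 3,
      (1 - p / 2) ^ (S.card * (n - S.card)) := by
    refine (prWeight_biUnion_le hw _ _).trans (Finset.sum_le_sum fun S _ => ?_)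
    rw [← card_cut]
    exact (PrGnp_avoid_of_isOriented p (isOriented_cut S)).le
  have hsup : {f | ¬ Reaches f a s} ∩ {f | ¬ Reaches f s b} ⊆
      E₁ ∪ E₂ ∪ E₃ ∪ (U ∪ V ∪ (W ∪ Z)) := by
    rintro f ⟨h1, h2⟩
    by_cases hf : ∀ S : Finset (Fin n), f ∈ avoid (cut S) → S.card ≤ 2 ∨ Sᶜ.card ≤ 2
    · rcases mem_avoid_of_not_reaches hn hsa hsb h1 h2 hf with
        h | h | h | ⟨x, y, h⟩ | ⟨x, y, h⟩ | ⟨x, y, h⟩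
      · exact Or.inl (Or.inl (Or.inl h))
      · exact Or.inl (Or.inl (Or.inr h))
      · exact Or.inl (Or.inr h)
      · exact Or.inr (Or.inl (Or.inl ⟨(x, y), h⟩))
      · exact Or.inr (Or.inl (Or.inr ⟨(x, y), h⟩))
      · exact Or.inr (Or.inr (Or.inl ⟨(x, y), trivial, h⟩))
    · push Not at hf
      obtain ⟨S, hS, hS1, hS2⟩ := hf
      rw [Finset.card_compl, Fintype.card_fin] at hS2
      refine Or.inr (Or.inr (Or.inr (Set.mem_biUnion (x := S) ?_ hS)))
      simp only [Finset.coe_filter, Finset.mem_univ, true_and, Set.mem_ofPred_eq]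
      omega
  have hlow := prWeight_mono hw hsub
  have hupp := prWeight_mono hw hsup
  have u1 := prWeight_union_le hw (E₁ ∪ E₂ ∪ E₃) (U ∪ V ∪ (W ∪ Z))
  have u2 := prWeight_union_le hw (U ∪ V) (W ∪ Z)
  have u3 := prWeight_union_le hw U V
  have u4 := prWeight_union_le hw W Z
  have u5 := prWeight_union_le hw (E₁ ∪ E₂) E₃
  have u6 := prWeight_union_le hw E₁ E₂
  have i1 := prWeight_union_add_inter (w := fun f : Config n => ∏ e, edgeWeight p (f e)) E₁ E₂
  have i2 := prWeight_union_add_inter (w := fun f : Config n => ∏ e, edgeWeight p (f e))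
    (E₁ ∪ E₂) E₃
  rw [Set.union_inter_distrib_right] at i2
  have i3 := prWeight_union_le hw (E₁ ∩ E₃) (E₂ ∩ E₃)
  have m1 := prWeight_mono hw h₁₂
  have m2 := prWeight_mono hw h₁₃
  have m3 := prWeight_mono hw h₂₃
  have q0 : 0 ≤ (1 - p / 2) ^ (3 * (n - 4)) := pow_nonneg (by linarith) _
  have q1 : 0 ≤ n ^ 2 * (1 - p / 2) ^ (3 * (n - 4)) := mul_nonneg (by positivity) q0
  have q2 : 0 ≤ n ^ 2 * (1 - p) ^ (n - 4) :=
    mul_nonneg (by positivity) (pow_nonneg (by linarith) _)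
  have q3 := (prWeight_nonneg hw Z).trans hZ'
  unfold jointError
  simp only [PrGnp] at *
  rw [abs_le]
  constructor <;> linarith

end JointEventBounds

section SecondMoment

lemma hypergeomGF_nonneg {L K k : ℕ} {t : ℝ} (hK : K ≤ L) (hk : k ≤ L) (ht : 0 ≤ t) :
    0 ≤ hypergeomGF L t K k := by
  obtain ⟨S, -, hS⟩ := Finset.exists_subset_card_eq
    (show K ≤ (Finset.univ : Finset (Fin L)).card by simpa using hK)
  have h := sum_powersetCard_pow_card_inter S t (k := k)
  rw [Fintype.card_fin, hS] at h
  have hpos : (0 : ℝ) < (L.choose k : ℝ) := by exact_mod_cast Nat.choose_pos hk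
  refine nonneg_of_mul_nonneg_right (h ▸ ?_) hpos
  exact Finset.sum_nonneg fun _ _ => pow_nonneg ht _

variable {n : ℕ} {p : ℝ}

/-- The rate at which the second-moment error terms decay in their size. -/
noncomputable def errorRate (p : ℝ) : ℝ := (1 - p / 2) * Real.exp (varParam p / 2)

/-- The sum of the error terms in the first and second moment estimates. -/
noncomputable def errorTotal (n : ℕ) (p : ℝ) : ℝ := ∑ i ∈ errorIndex n, errorRate p ^ errorSize n i

lemma varParam_nonneg (hp : p ∈ Set.Ioc (0 : ℝ) 1) : 0 ≤ varParam p :=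
  div_nonneg (mul_nonneg hp.1.le (by linarith [hp.2])) (sq_nonneg _)

lemma errorRate_pow (p : ℝ) (K : ℕ) :
    errorRate p ^ K = (1 - p / 2) ^ K * Real.exp (varParam p * (K / 2)) := by
  rw [errorRate, mul_pow, ← Real.exp_nat_mul]
  congr 2
  ring

lemma sum_PrGnp_edgeCount_mul_hypergeomGF_mul (hp : p ∈ Set.Ioc (0 : ℝ) 1) {K k : ℕ}
    (hK : K ≤ n.choose 2) (hk : k ≤ n.choose 2) :
    ∑ m ∈ Finset.range (n.choose 2 + 1), PrGnp n p {f | edgeCount f = m} *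
        (hypergeomGF (n.choose 2) (1 / 2) K m * hypergeomGF (n.choose 2) (1 / 2) k m) =
      (1 - p / 2) ^ (K + k) * hypergeomGF (n.choose 2) (1 + varParam p) K k := by
  rw [← sum_binomial_mul_hypergeomGF hp hK hk]
  refine Finset.sum_congr rfl fun m hm => ?_
  rw [PrGnp_edgeCount (Nat.lt_succ_iff.mp (Finset.mem_range.mp hm))]

lemma sum_PrGnp_edgeCount_mul_hypergeomGF (hp : p ∈ Set.Ioc (0 : ℝ) 1) {K : ℕ}
    (hK : K ≤ n.choose 2) :
    ∑ m ∈ Finset.range (n.choose 2 + 1), PrGnp n p {f | edgeCount f = m} *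
        hypergeomGF (n.choose 2) (1 / 2) K m = (1 - p / 2) ^ K := by
  have h := sum_PrGnp_edgeCount_mul_hypergeomGF_mul (n := n) hp hK (Nat.zero_le _)
  simp only [hypergeomGF_zero, mul_one, add_zero, hypergeomGF_comm _ _ 0] at h
  rw [← h]

lemma pow_mul_hypergeomGF_le (hp : p ∈ Set.Ioc (0 : ℝ) 1) {K k L : ℕ} (hK : K ≤ L) (hk : k ≤ L)
    (hL : 0 < L) {c : ℝ} (hc : (K : ℝ) * k / L ≤ c) :
    (1 - p / 2) ^ (K + k) * hypergeomGF L (1 + varParam p) K k ≤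
      (1 - p / 2) ^ (K + k) * Real.exp (varParam p * c) := by
  have := hp.2
  have hr := varParam_nonneg hp
  refine mul_le_mul_of_nonneg_left ?_ (pow_nonneg (by linarith) _)
  exact (hypergeomGF_le_exp hK hk hL hr).trans
    (Real.exp_le_exp.mpr (mul_le_mul_of_nonneg_left hc hr))

lemma pow_mul_hypergeomGF_le_errorRate (hp : p ∈ Set.Ioc (0 : ℝ) 1) {K k L : ℕ} (hK : K ≤ L)
    (hk : k ≤ L) (hL : 0 < L) :
    (1 - p / 2) ^ (K + k) * hypergeomGF L (1 + varParam p) K k ≤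
      errorRate p ^ K * errorRate p ^ k := by
  have hL' : (0 : ℝ) < L := by exact_mod_cast hL
  have hK' : (K : ℝ) ≤ L := by exact_mod_cast hK
  have hk' : (k : ℝ) ≤ L := by exact_mod_cast hk
  refine (pow_mul_hypergeomGF_le hp hK hk hL (c := ((K + k : ℕ) : ℝ) / 2) ?_).trans ?_
  · rw [div_le_div_iff₀ hL' two_pos]
    push_cast
    nlinarith [mul_nonneg (Nat.cast_nonneg (α := ℝ) K) (sub_nonneg.mpr hk'),
      mul_nonneg (Nat.cast_nonneg (α := ℝ) k) (sub_nonneg.mpr hK')]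
  · rw [← pow_add, errorRate_pow]

lemma cast_choose_two_of_one_le (hn : 1 ≤ n) :
    ((n.choose 2 : ℕ) : ℝ) = n * ((n - 1 : ℕ) : ℝ) / 2 := by
  rw [Nat.cast_choose_two, Nat.cast_sub hn, Nat.cast_one]

lemma pow_mul_hypergeomGF_le_pow_mul_errorRate (hp : p ∈ Set.Ioc (0 : ℝ) 1) (hn : 4 ≤ n) {K : ℕ}
    (hK : K ≤ n.choose 2) :
    (1 - p / 2) ^ (n - 1 + K) * hypergeomGF (n.choose 2) (1 + varParam p) (n - 1) K ≤
      (1 - p / 2) ^ (n - 1) * errorRate p ^ K := by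
  have h1 : n - 1 ≤ n.choose 2 := by
    have := errorSize_le (show 3 ≤ n by omega) none
    simp only [errorSize] at this
    omega
  refine (pow_mul_hypergeomGF_le hp h1 hK (Nat.choose_pos (by omega)) (c := K / 2) ?_).trans ?_
  · have hn' : (4 : ℝ) ≤ n := by exact_mod_cast hn
    have hn1 : (0 : ℝ) < ((n - 1 : ℕ) : ℝ) := by exact_mod_cast (show 0 < n - 1 by omega)
    rw [cast_choose_two_of_one_le (by omega), div_le_div_iff₀ (by positivity) two_pos]
    nlinarith [mul_nonneg (mul_nonneg (Nat.cast_nonneg (α := ℝ) K) hn1.le) (sub_nonneg.mpr hn')]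
  · rw [errorRate_pow, pow_add, mul_assoc]

lemma errorRate_nonneg (hp : p ∈ Set.Ioc (0 : ℝ) 1) : 0 ≤ errorRate p :=
  mul_nonneg (by linarith [hp.2]) (Real.exp_pos _).le

lemma errorTotal_nonneg (hp : p ∈ Set.Ioc (0 : ℝ) 1) : 0 ≤ errorTotal n p :=
  Finset.sum_nonneg fun _ _ => pow_nonneg (errorRate_nonneg hp) _

lemma sum_mul_sum_hypergeomGF_le (hp : p ∈ Set.Ioc (0 : ℝ) 1) (hn : 4 ≤ n) :
    ∑ m ∈ Finset.range (n.choose 2 + 1), PrGnp n p {f | edgeCount f = m} *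
        (hypergeomGF (n.choose 2) (1 / 2) (n - 1) m *
          ∑ i ∈ errorIndex n, hypergeomGF (n.choose 2) (1 / 2) (errorSize n i) m) ≤
      (1 - p / 2) ^ (n - 1) * errorTotal n p := by
  simp_rw [errorTotal, Finset.mul_sum]
  rw [Finset.sum_comm]
  refine Finset.sum_le_sum fun i _ => ?_
  have hi := errorSize_le (show 3 ≤ n by omega) i
  have h1 := errorSize_le (show 3 ≤ n by omega) none
  simp only [errorSize] at h1
  rw [sum_PrGnp_edgeCount_mul_hypergeomGF_mul hp (by omega) hi]
  exact pow_mul_hypergeomGF_le_pow_mul_errorRate hp hn hi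

lemma sum_mul_sum_hypergeomGF_sq_le (hp : p ∈ Set.Ioc (0 : ℝ) 1) (hn : 3 ≤ n) :
    ∑ m ∈ Finset.range (n.choose 2 + 1), PrGnp n p {f | edgeCount f = m} *
        (∑ i ∈ errorIndex n, hypergeomGF (n.choose 2) (1 / 2) (errorSize n i) m) ^ 2 ≤
      errorTotal n p ^ 2 := by
  simp_rw [errorTotal, sq, Finset.sum_mul_sum, Finset.mul_sum]
  rw [Finset.sum_comm]
  refine Finset.sum_le_sum fun i _ => ?_
  rw [Finset.sum_comm]
  refine Finset.sum_le_sum fun j _ => ?_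
  rw [sum_PrGnp_edgeCount_mul_hypergeomGF_mul hp (errorSize_le hn i) (errorSize_le hn j)]
  exact pow_mul_hypergeomGF_le_errorRate hp (errorSize_le hn i) (errorSize_le hn j)
    (Nat.choose_pos (by omega))

lemma abs_sum_PrGnm_mul_sub_le (hp : p ∈ Set.Ioc (0 : ℝ) 1) (hn : 4 ≤ n) {x y z w : Fin n}
    (hxy : x ≠ y) (hzw : z ≠ w) :
    |∑ m ∈ Finset.range (n.choose 2 + 1), PrGnp n p {f | edgeCount f = m} *
        (PrGnm n m {f | ¬ Reaches f x y} * PrGnm n m {f | ¬ Reaches f z w}) -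
      4 * (1 - p / 2) ^ (2 * n - 2) *
        hypergeomGF (n.choose 2) (1 + varParam p) (n - 1) (n - 1)| ≤
      4 * (1 - p / 2) ^ (n - 1) * errorTotal n p + errorTotal n p ^ 2 := by
  have h1 := errorSize_le (show 3 ≤ n by omega) none
  simp only [errorSize] at h1
  have hmain := sum_PrGnp_edgeCount_mul_hypergeomGF_mul (n := n) (K := n - 1) (k := n - 1) hp
    (by omega) (by omega)
  rw [show n - 1 + (n - 1) = 2 * n - 2 by omega] at hmain
  rw [mul_assoc, ← hmain, Finset.mul_sum, ← Finset.sum_sub_distrib]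
  refine (Finset.abs_sum_le_sum_abs _ _).trans ?_
  have hle : 4 * ∑ m ∈ Finset.range (n.choose 2 + 1), PrGnp n p {f | edgeCount f = m} *
        (hypergeomGF (n.choose 2) (1 / 2) (n - 1) m *
          ∑ i ∈ errorIndex n, hypergeomGF (n.choose 2) (1 / 2) (errorSize n i) m) +
      ∑ m ∈ Finset.range (n.choose 2 + 1), PrGnp n p {f | edgeCount f = m} *
        (∑ i ∈ errorIndex n, hypergeomGF (n.choose 2) (1 / 2) (errorSize n i) m) ^ 2 ≤
      4 * (1 - p / 2) ^ (n - 1) * errorTotal n p + errorTotal n p ^ 2 := by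
    linarith [sum_mul_sum_hypergeomGF_le hp hn,
      sum_mul_sum_hypergeomGF_sq_le hp (show 3 ≤ n by omega)]
  refine le_trans ?_ hle
  rw [Finset.mul_sum, ← Finset.sum_add_distrib]
  refine Finset.sum_le_sum fun m hm => ?_
  have hm' := Nat.lt_succ_iff.mp (Finset.mem_range.mp hm)
  have hX := abs_PrGnm_not_reaches_sub_le (show 3 ≤ n by omega) hm' hxy
  have hY := abs_PrGnm_not_reaches_sub_le (show 3 ≤ n by omega) hm' hzw
  have hf : 0 ≤ hypergeomGF (n.choose 2) (1 / 2) (n - 1) m :=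
    hypergeomGF_nonneg (by omega) hm' (by norm_num)
  have hW : 0 ≤ PrGnp n p {f | edgeCount f = m} := prWeight_nonneg (PrGnp_weight_nonneg hp) _
  generalize PrGnp n p {f | edgeCount f = m} = W at *
  generalize PrGnm n m {f | ¬ Reaches f x y} = X at *
  generalize PrGnm n m {f | ¬ Reaches f z w} = Y at *
  generalize hypergeomGF (n.choose 2) (1 / 2) (n - 1) m = u at *
  generalize ∑ i ∈ errorIndex n, hypergeomGF (n.choose 2) (1 / 2) (errorSize n i) m = h at *
  have hXY : |X * Y - 4 * (u * u)| ≤ 4 * (u * h) + h ^ 2 := by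
    have e : X * Y - 4 * (u * u) =
        (X - 2 * u) * (Y - 2 * u) + 2 * u * ((X - 2 * u) + (Y - 2 * u)) := by ring
    have a1 : |(X - 2 * u) * (Y - 2 * u)| ≤ h * h := by
      rw [abs_mul]
      exact mul_le_mul hX hY (abs_nonneg _) ((abs_nonneg _).trans hX)
    have a2 : |2 * u * ((X - 2 * u) + (Y - 2 * u))| ≤ 2 * u * (h + h) := by
      rw [abs_mul, abs_of_nonneg (show 0 ≤ 2 * u by linarith)]
      exact mul_le_mul_of_nonneg_left ((abs_add_le _ _).trans (add_le_add hX hY)) (by linarith)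
    rw [e]
    refine (abs_add_le _ _).trans ((add_le_add a1 a2).trans (le_of_eq ?_))
    ring
  calc |W * (X * Y) - 4 * (W * (u * u))| = W * |X * Y - 4 * (u * u)| := by
        rw [← abs_of_nonneg hW, ← abs_mul, abs_of_nonneg hW]
        congr 1
        ring
    _ ≤ W * (4 * (u * h) + h ^ 2) := mul_le_mul_of_nonneg_left hXY hW
    _ = _ := by ring

lemma abs_PrGnp_not_reaches_sub_le (hp : p ∈ Set.Ioc (0 : ℝ) 1) (hn : 3 ≤ n) {x y : Fin n}
    (hxy : x ≠ y) :
    |PrGnp n p {f | ¬ Reaches f x y} - 2 * (1 - p / 2) ^ (n - 1)| ≤ errorTotal n p := by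
  have h1 := errorSize_le hn none
  simp only [errorSize] at h1
  have hp2 := hp.2
  rw [← sum_PrGnp_edgeCount_mul_PrGnm,
    ← sum_PrGnp_edgeCount_mul_hypergeomGF (n := n) hp (show n - 1 ≤ n.choose 2 by omega),
    Finset.mul_sum, ← Finset.sum_sub_distrib]
  refine (Finset.abs_sum_le_sum_abs _ _).trans ?_
  have hle : ∑ m ∈ Finset.range (n.choose 2 + 1), PrGnp n p {f | edgeCount f = m} *
      ∑ i ∈ errorIndex n, hypergeomGF (n.choose 2) (1 / 2) (errorSize n i) m ≤
        errorTotal n p := by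
    simp_rw [Finset.mul_sum]
    rw [Finset.sum_comm]
    refine Finset.sum_le_sum fun i _ => ?_
    rw [sum_PrGnp_edgeCount_mul_hypergeomGF hp (errorSize_le hn i), errorRate_pow]
    refine le_mul_of_one_le_right (pow_nonneg (by linarith) _) (Real.one_le_exp ?_)
    exact mul_nonneg (varParam_nonneg hp) (by positivity)
  refine le_trans (Finset.sum_le_sum fun m hm => ?_) hle
  have hX := abs_PrGnm_not_reaches_sub_le hn (Nat.lt_succ_iff.mp (Finset.mem_range.mp hm)) hxy
  have hW : 0 ≤ PrGnp n p {f | edgeCount f = m} := prWeight_nonneg (PrGnp_weight_nonneg hp) _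
  rw [mul_left_comm, ← mul_sub, abs_mul, abs_of_nonneg hW]
  exact mul_le_mul_of_nonneg_left hX hW

lemma abs_PrGnp_not_reaches_sq_sub_le (hp : p ∈ Set.Ioc (0 : ℝ) 1) (hn : 3 ≤ n) {x y : Fin n}
    (hxy : x ≠ y) :
    |PrGnp n p {f | ¬ Reaches f x y} ^ 2 - 4 * (1 - p / 2) ^ (2 * n - 2)| ≤
      4 * (1 - p / 2) ^ (n - 1) * errorTotal n p + errorTotal n p ^ 2 := by
  have h := abs_PrGnp_not_reaches_sub_le hp hn hxy
  have hq : 0 ≤ (1 - p / 2) ^ (n - 1) := pow_nonneg (by linarith [hp.2]) _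
  rw [show 2 * n - 2 = (n - 1) * 2 by omega, pow_mul]
  generalize (1 - p / 2) ^ (n - 1) = u at *
  generalize PrGnp n p {f | ¬ Reaches f x y} = X at *
  generalize errorTotal n p = t at *
  rw [abs_le] at h ⊢
  constructor <;> nlinarith

end SecondMoment

section Asymptotics

/-- The sum of `c ^ (|S| * (n - |S|))` over the nonempty proper subsets `S` of `Fin n`. -/
noncomputable def cutSum (c : ℝ) (n : ℕ) : ℝ :=
  ∑ S : Finset (Fin n) with 1 ≤ S.card ∧ S.card ≤ n - 1, c ^ (S.card * (n - S.card))

lemma pow_mul_sub_le {c : ℝ} (hc0 : 0 ≤ c) (hc1 : c ≤ 1) {k n : ℕ} (hk : k ≤ n) :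
    (c ^ 2) ^ (k * (n - k)) ≤ (c ^ n) ^ k + (c ^ n) ^ (n - k) := by
  have h1 : 0 ≤ (c ^ n) ^ k := by positivity
  have h2 : 0 ≤ (c ^ n) ^ (n - k) := by positivity
  obtain ⟨l, rfl⟩ := Nat.exists_eq_add_of_le hk
  rw [Nat.add_sub_cancel_left] at *
  rcases le_total k l with h | h
  · have h3 : (c ^ 2) ^ (k * l) ≤ (c ^ (k + l)) ^ k := by
      rw [← pow_mul, ← pow_mul]
      exact pow_le_pow_of_le_one hc0 hc1 (by nlinarith)
    linarith
  · have h3 : (c ^ 2) ^ (k * l) ≤ (c ^ (k + l)) ^ l := by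
      rw [← pow_mul, ← pow_mul]
      exact pow_le_pow_of_le_one hc0 hc1 (by nlinarith)
    linarith

lemma cutSum_sq_le {c : ℝ} (hc0 : 0 ≤ c) (hc1 : c ≤ 1) (n : ℕ) :
    cutSum (c ^ 2) n ≤ 2 * (Real.exp (n * c ^ n) - 1) := by
  set ρ := c ^ n
  have hρ : 0 ≤ ρ := pow_nonneg hc0 n
  have hexp : (1 + ρ) ^ n ≤ Real.exp (n * ρ) := by
    rw [Real.exp_nat_mul, add_comm]
    exact pow_le_pow_left₀ (by positivity) (Real.add_one_le_exp ρ) n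
  have h1 : ∑ S : Finset (Fin n), ρ ^ S.card = (1 + ρ) ^ n := by
    have := Fintype.sum_pow_mul_eq_add_pow (Fin n) ρ 1
    simpa [add_comm] using this
  have h2 : ∑ S : Finset (Fin n), ρ ^ (n - S.card) = (1 + ρ) ^ n := by
    have := Fintype.sum_pow_mul_eq_add_pow (Fin n) 1 ρ
    simpa using this
  have h3 : ∑ S : Finset (Fin n) with 1 ≤ S.card ∧ S.card ≤ n - 1, ρ ^ S.card ≤
      (1 + ρ) ^ n - 1 := by
    rw [← h1, ← Finset.sum_erase_add _ _ (Finset.mem_univ ∅), Finset.card_empty, pow_zero,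
      add_sub_cancel_right]
    refine Finset.sum_le_sum_of_subset_of_nonneg ?_ fun _ _ _ => pow_nonneg hρ _
    rintro S hS
    rw [Finset.mem_erase]
    refine ⟨?_, Finset.mem_univ S⟩
    rintro rfl
    simp at hS
  have h4 : ∑ S : Finset (Fin n) with 1 ≤ S.card ∧ S.card ≤ n - 1, ρ ^ (n - S.card) ≤
      (1 + ρ) ^ n - 1 := by
    rw [← h2, ← Finset.sum_erase_add _ _ (Finset.mem_univ Finset.univ), Finset.card_univ,
      Fintype.card_fin, Nat.sub_self, pow_zero, add_sub_cancel_right]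
    refine Finset.sum_le_sum_of_subset_of_nonneg ?_ fun _ _ _ => pow_nonneg hρ _
    rintro S hS
    rw [Finset.mem_erase]
    refine ⟨?_, Finset.mem_univ S⟩
    rintro rfl
    simp only [Finset.mem_filter, Finset.mem_univ, true_and, Finset.card_univ,
      Fintype.card_fin] at hS
    omega
  calc cutSum (c ^ 2) n
      ≤ ∑ S : Finset (Fin n) with 1 ≤ S.card ∧ S.card ≤ n - 1,
          (ρ ^ S.card + ρ ^ (n - S.card)) := by
        refine Finset.sum_le_sum fun S hS => pow_mul_sub_le hc0 hc1 ?_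
        simpa using Finset.card_le_univ S
    _ ≤ 2 * (Real.exp (n * ρ) - 1) := by
        rw [Finset.sum_add_distrib]
        linarith

lemma cutSum_nonneg {c : ℝ} (hc0 : 0 ≤ c) (n : ℕ) : 0 ≤ cutSum c n :=
  Finset.sum_nonneg fun _ _ => pow_nonneg hc0 _

lemma tendsto_cutSum {c : ℝ} (hc0 : 0 ≤ c) (hc1 : c < 1) :
    Tendsto (cutSum c) atTop (nhds 0) := by
  have hs : √c < 1 := (Real.sqrt_lt' one_pos).mpr (by rwa [one_pow])
  have h : Tendsto (fun n : ℕ => 2 * (Real.exp (n * √c ^ n) - 1)) atTop (nhds 0) := by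
    have h1 := tendsto_self_mul_const_pow_of_lt_one (Real.sqrt_nonneg c) hs
    have h2 := ((Real.continuous_exp.tendsto 0).comp h1).sub_const 1 |>.const_mul 2
    simpa using h2
  refine squeeze_zero (cutSum_nonneg hc0) (fun n => ?_) h
  have := cutSum_sq_le (Real.sqrt_nonneg c) hs.le n
  rwa [Real.sq_sqrt hc0] at this

variable {p : ℝ}

lemma varParam_le (hp : p ∈ Set.Ioc (0 : ℝ) 1) : varParam p ≤ p / 4 := by
  obtain ⟨hp1, hp2⟩ := hp
  have h : 0 < (2 - p) ^ 2 := by nlinarith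
  rw [varParam, div_le_div_iff₀ h (by norm_num)]
  nlinarith [mul_nonneg hp1.le (sq_nonneg p)]

lemma errorRate_lt (hp : p ∈ Set.Ioc (0 : ℝ) 1) : errorRate p < √(1 - p / 2) := by
  have hr := varParam_le hp
  obtain ⟨hp1, hp2⟩ := hp
  have hq : 0 < 1 - p / 2 := by linarith
  refine Real.lt_sqrt_of_sq_lt ?_
  rw [errorRate, mul_pow, ← Real.exp_nat_mul, sq, mul_assoc]
  refine mul_lt_of_lt_one_right hq ?_
  have h1 : 1 - p / 2 ≤ Real.exp (-(p / 2)) := by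
    linarith [Real.add_one_le_exp (-(p / 2))]
  calc (1 - p / 2) * Real.exp (((2 : ℕ) : ℝ) * (varParam p / 2))
      ≤ Real.exp (-(p / 2)) * Real.exp (p / 4) := by
        refine mul_le_mul h1 (Real.exp_le_exp.mpr ?_) (Real.exp_pos _).le (Real.exp_pos _).le
        push_cast
        linarith
    _ < 1 := by
        rw [← Real.exp_add, Real.exp_lt_one_iff]
        linarith

lemma errorTotal_le (hp : p ∈ Set.Ioc (0 : ℝ) 1) (n : ℕ) :
    errorTotal n p ≤ (1 - p / 2) ^ (n - 2) * ((errorRate p / √(1 - p / 2)) ^ (2 * n - 3) +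
      cutSum (errorRate p / √(1 - p / 2)) n) := by
  have hq : 0 < 1 - p / 2 := by linarith [hp.2]
  have hs := Real.sqrt_pos.mpr hq
  have hs1 : √(1 - p / 2) ≤ 1 := Real.sqrt_le_one.mpr (by linarith [hp.1])
  set σ := errorRate p / √(1 - p / 2) with hσ
  have hσ0 : 0 ≤ σ := div_nonneg (errorRate_nonneg hp) hs.le
  have hstep : errorTotal n p ≤
      (1 - p / 2) ^ (n - 2) * ∑ i ∈ errorIndex n, σ ^ errorSize n i := by
    rw [errorTotal, Finset.mul_sum]
    refine Finset.sum_le_sum fun i hi => ?_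
    have h1 : errorRate p = √(1 - p / 2) * σ := by
      rw [hσ, mul_div_cancel₀ _ hs.ne']
    have h2 : (1 - p / 2) ^ (n - 2) = √(1 - p / 2) ^ (2 * (n - 2)) := by
      rw [pow_mul, Real.sq_sqrt hq.le]
    rw [h1, mul_pow, h2]
    exact mul_le_mul_of_nonneg_right (pow_le_pow_of_le_one hs.le hs1 (le_errorSize hi))
      (pow_nonneg hσ0 _)
  refine hstep.trans (mul_le_mul_of_nonneg_left ?_ (pow_nonneg hq.le _))
  rw [errorIndex, Finset.sum_insertNone]
  simp only [errorSize]
  refine add_le_add le_rfl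
    (Finset.sum_le_sum_of_subset_of_nonneg ?_ fun _ _ _ => pow_nonneg hσ0 _)
  intro S hS
  simp only [Finset.mem_filter, Finset.mem_univ, true_and] at hS ⊢
  omega

lemma tendsto_errorTotal_div (hp : p ∈ Set.Ioc (0 : ℝ) 1) :
    Tendsto (fun n => errorTotal n p / (1 - p / 2) ^ n) atTop (nhds 0) := by
  have hq : 0 < 1 - p / 2 := by linarith [hp.2]
  have hs := Real.sqrt_pos.mpr hq
  set σ := errorRate p / √(1 - p / 2) with hσ
  have hσ0 : 0 ≤ σ := div_nonneg (errorRate_nonneg hp) hs.le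
  have hσ1 : σ < 1 := (div_lt_one hs).mpr (errorRate_lt hp)
  have h1 : Tendsto (fun n : ℕ => 2 * n - 3) atTop atTop :=
    tendsto_atTop_mono (fun n => by omega) (tendsto_sub_atTop_nat 3)
  have h2 := (((tendsto_pow_atTop_nhds_zero_of_lt_one hσ0 hσ1).comp h1).add
    (tendsto_cutSum hσ0 hσ1)).const_mul ((1 - p / 2) ^ 2)⁻¹
  rw [add_zero, mul_zero] at h2
  refine squeeze_zero' (Eventually.of_forall fun n =>
    div_nonneg (errorTotal_nonneg hp) (pow_nonneg hq.le _)) ?_ h2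
  filter_upwards [eventually_ge_atTop 2] with n hn
  rw [div_le_iff₀ (pow_pos hq n)]
  refine (errorTotal_le hp n).trans (le_of_eq ?_)
  rw [← hσ]
  clear_value σ
  obtain ⟨k, rfl⟩ := Nat.exists_eq_add_of_le' hn
  rw [Nat.add_sub_cancel, pow_add]
  simp only [Function.comp]
  generalize 1 - p / 2 = q at *
  field_simp

lemma tendsto_momentError_div (hp : p ∈ Set.Ioc (0 : ℝ) 1) :
    Tendsto (fun n => (4 * (1 - p / 2) ^ (n - 1) * errorTotal n p + errorTotal n p ^ 2) /
      (1 - p / 2) ^ (2 * n)) atTop (nhds 0) := by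
  have hq : 0 < 1 - p / 2 := by linarith [hp.2]
  have h := tendsto_errorTotal_div hp
  have h1 := (h.const_mul (4 * (1 - p / 2)⁻¹)).add (h.pow 2)
  rw [mul_zero, zero_pow two_ne_zero, add_zero] at h1
  refine h1.congr' ?_
  filter_upwards [eventually_ge_atTop 1] with n hn
  obtain ⟨k, rfl⟩ := Nat.exists_eq_add_of_le' hn
  rw [Nat.add_sub_cancel, two_mul, pow_add _ (k + 1), pow_succ _ k]
  field_simp

lemma tendsto_jointError_div (hp : p ∈ Set.Ioc (0 : ℝ) 1) :
    Tendsto (fun n => jointError n p / (1 - p / 2) ^ (2 * n)) atTop (nhds 0) := by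
  have hq : 0 < 1 - p / 2 := by linarith [hp.2]
  have hq1 : 1 - p / 2 < 1 := by linarith [hp.1]
  have h1p : 0 ≤ 1 - p := by linarith [hp.2]
  set v := (1 - p / 2) ^ ((3 : ℕ) : ℝ)⁻¹ with hv
  have hv0 : 0 ≤ v := Real.rpow_nonneg hq.le _
  have hv1 : v < 1 := Real.rpow_lt_one hq.le hq1 (by norm_num)
  have hv3 : v ^ 3 = 1 - p / 2 := Real.rpow_inv_natCast_pow hq.le (by norm_num)
  have hcut : ∀ n, ∑ S : Finset (Fin n) with 3 ≤ S.card ∧ S.card ≤ n - 3,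
      (1 - p / 2) ^ (S.card * (n - S.card)) ≤ (1 - p / 2) ^ (2 * (n - 3)) * cutSum v n := by
    intro n
    rw [cutSum, Finset.mul_sum]
    refine (Finset.sum_le_sum (g := fun S : Finset (Fin n) =>
      (1 - p / 2) ^ (2 * (n - 3)) * v ^ (S.card * (n - S.card))) fun S hS => ?_).trans
      (Finset.sum_le_sum_of_subset_of_nonneg ?_ fun _ _ _ => by positivity)
    · simp only [Finset.mem_filter, Finset.mem_univ, true_and] at hS
      obtain ⟨l, hl⟩ := Nat.exists_eq_add_of_le (show S.card ≤ n by omega)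
      rw [← hv3, ← pow_mul, ← pow_mul, ← pow_add]
      refine pow_le_pow_of_le_one hv0 hv1.le ?_
      have h3 : n - S.card = l := by omega
      rw [h3]
      have h4 : 3 * (n - 3) ≤ S.card * l := by
        obtain ⟨c, hc⟩ := Nat.exists_eq_add_of_le hS.1
        obtain ⟨d, hd⟩ := Nat.exists_eq_add_of_le (show 3 ≤ l by omega)
        rw [hc, hd, show n - 3 = c + d + 3 by omega]
        nlinarith
      omega
    · intro S hS
      simp only [Finset.mem_filter, Finset.mem_univ, true_and] at hS ⊢
      omega
  rw [← tendsto_add_atTop_iff_nat 4]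
  have hc1 : (1 - p) / (1 - p / 2) ^ 2 < 1 := by
    rw [div_lt_one (by positivity)]
    nlinarith [hp.1]
  have hc0 : 0 ≤ (1 - p) / (1 - p / 2) ^ 2 := by positivity
  have hpoly : ∀ {c : ℝ}, 0 ≤ c → c < 1 → ∀ u w : ℝ,
      Tendsto (fun n : ℕ => (u * ((n + 4 : ℕ) : ℝ) ^ 2 + w) * c ^ n) atTop (nhds 0) := by
    intro c h0 h1 u w
    have e2 := (tendsto_pow_const_mul_const_pow_of_lt_one 2 h0 h1).const_mul u
    have e1 := (tendsto_pow_const_mul_const_pow_of_lt_one 1 h0 h1).const_mul (8 * u)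
    have e0 := (tendsto_pow_atTop_nhds_zero_of_lt_one h0 h1).const_mul (16 * u + w)
    have e := (e2.add e1).add e0
    simp only [mul_zero, add_zero] at e
    refine e.congr fun n => ?_
    push_cast
    ring
  have hlim := ((((tendsto_add_atTop_iff_nat 4).mpr (tendsto_cutSum hv0 hv1)).const_mul
    ((1 - p / 2) ^ 6)⁻¹).add ((hpoly hq.le hq1 2 3).const_mul ((1 - p / 2) ^ 8)⁻¹)).add
    ((hpoly hc0 hc1 1 0).const_mul ((1 - p / 2) ^ 8)⁻¹)
  simp only [mul_zero, add_zero] at hlim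
  refine squeeze_zero (fun n => ?_) (fun n => ?_) hlim
  · unfold jointError
    positivity
  · rw [div_le_iff₀ (by positivity), jointError, Nat.add_sub_cancel]
    refine (add_le_add (add_le_add (hcut _) le_rfl) le_rfl).trans (le_of_eq ?_)
    rw [show 2 * (n + 4 - 3) = 2 * n + 2 by omega, div_pow]
    generalize 1 - p / 2 = q at *
    field_simp
    push_cast
    ring

end Asymptotics

section Limits

lemma tendsto_choose_two_atTop : Tendsto (fun n : ℕ => n.choose 2) atTop atTop := by
  refine tendsto_atTop_mono (fun n => ?_) (tendsto_sub_atTop_nat 1)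
  cases n with
  | zero => simp
  | succ n =>
    rw [Nat.add_sub_cancel, Nat.choose_succ_succ' n 1, Nat.choose_one_right]
    omega

lemma tendsto_pred_mul_pred_div_choose_two :
    Tendsto (fun n : ℕ => ((n - 1 : ℕ) : ℝ) * ((n - 1 : ℕ) : ℝ) / ((n.choose 2 : ℕ) : ℝ))
      atTop (nhds 2) := by
  have h : Tendsto (fun n : ℕ => 2 - 2 * (1 / (n : ℝ))) atTop (nhds 2) := by
    simpa using (tendsto_one_div_atTop_nhds_zero_nat (𝕜 := ℝ)).const_mul 2 |>.const_sub 2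
  refine h.congr' ?_
  filter_upwards [eventually_ge_atTop 2] with n hn
  have hn0 : (n : ℝ) ≠ 0 := by positivity
  have hn1 : (n : ℝ) - 1 ≠ 0 := by
    have : (2 : ℝ) ≤ n := by exact_mod_cast hn
    linarith
  rw [Nat.cast_choose_two, Nat.cast_sub (by omega), Nat.cast_one]
  field_simp

lemma tendsto_choose_mul_choose_div (j : ℕ) :
    Tendsto (fun n : ℕ => ((n - 1).choose j : ℝ) * ((n - 1).choose j : ℝ) /
      ((n.choose 2).choose j : ℝ)) atTop (nhds (2 ^ j / (j.factorial : ℝ))) := by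
  have h1 := (isEquivalent_choose j).comp_tendsto (tendsto_sub_atTop_nat 1)
  have h2 := (isEquivalent_choose j).comp_tendsto tendsto_choose_two_atTop
  refine ((h1.mul h1).div h2).symm.tendsto_nhds ?_
  have h3 := (tendsto_pred_mul_pred_div_choose_two.pow j).div_const (j.factorial : ℝ)
  refine h3.congr fun n => ?_
  have hj : (j.factorial : ℝ) ≠ 0 := by positivity
  simp only [Function.comp, Pi.mul_apply, Pi.div_apply, div_pow, mul_pow]
  field_simp

lemma tendsto_hypergeomGF {r : ℝ} (hr : 0 ≤ r) :
    Tendsto (fun n : ℕ => hypergeomGF (n.choose 2) (1 + r) (n - 1) (n - 1)) atTop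
      (nhds (Real.exp (2 * r))) := by
  have hsum : ∀ n : ℕ, hypergeomGF (n.choose 2) (1 + r) (n - 1) (n - 1) =
      ∑' j, r ^ j * (((n - 1).choose j : ℝ) * ((n - 1).choose j : ℝ) /
        ((n.choose 2).choose j : ℝ)) := by
    intro n
    rw [hypergeomGF, tsum_eq_sum (s := Finset.range (n.choose 2 + 1)), add_sub_cancel_left]
    intro j hj
    rw [Nat.choose_eq_zero_of_lt (n := n.choose 2) (by simpa using hj)]
    simp
  have hexp : Real.exp (2 * r) = ∑' j : ℕ, r ^ j * (2 ^ j / (j.factorial : ℝ)) := by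
    rw [Real.exp_eq_exp_ℝ, NormedSpace.exp_eq_tsum_div]
    refine tsum_congr fun j => ?_
    rw [mul_pow]
    ring
  simp_rw [hsum, hexp]
  refine tendsto_tsum_of_dominated_convergence (bound := fun j => (2 * r) ^ j / (j.factorial : ℝ))
    (Real.summable_pow_div_factorial _) (fun j => (tendsto_choose_mul_choose_div j).const_mul _) ?_
  filter_upwards [eventually_ge_atTop 3] with n hn j
  have hL : 0 < n.choose 2 := Nat.choose_pos (by omega)
  have hK : n - 1 ≤ n.choose 2 := by
    have := errorSize_le hn none
    simp only [errorSize] at this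
    omega
  have h2 : ((n - 1 : ℕ) : ℝ) * ((n - 1 : ℕ) : ℝ) / ((n.choose 2 : ℕ) : ℝ) ≤ 2 := by
    rw [div_le_iff₀ (by exact_mod_cast hL), cast_choose_two_of_one_le (by omega)]
    have h : ((n - 1 : ℕ) : ℝ) ≤ n := by exact_mod_cast Nat.sub_le n 1
    nlinarith [mul_le_mul_of_nonneg_right h (Nat.cast_nonneg (α := ℝ) (n - 1))]
  rw [Real.norm_of_nonneg (by positivity)]
  calc r ^ j * (((n - 1).choose j : ℝ) * ((n - 1).choose j : ℝ) / ((n.choose 2).choose j : ℝ))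
      ≤ r ^ j * (2 ^ j / (j.factorial : ℝ)) := by
        refine mul_le_mul_of_nonneg_left ((choose_mul_choose_div_le hK hK hL j).trans ?_)
          (pow_nonneg hr j)
        gcongr
    _ = (2 * r) ^ j / (j.factorial : ℝ) := by
        rw [mul_pow]
        ring

lemma tendsto_div_of_abs_sub_mul_le {u v e : ℕ → ℝ} {q l : ℝ} (hq0 : 0 < q) (hq1 : q ≤ 1)
    {d k : ℕ → ℕ} (hd : ∀ n, d n ≤ k n) (hv : Tendsto v atTop (nhds l))
    (he : Tendsto (fun n => e n / q ^ k n) atTop (nhds 0))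
    (hu : ∀ᶠ n in atTop, |u n - v n * q ^ d n| ≤ e n) :
    Tendsto (fun n => u n / q ^ d n) atTop (nhds l) := by
  have h : Tendsto (fun n => u n / q ^ d n - v n) atTop (nhds 0) := by
    refine squeeze_zero_norm' ?_ he
    filter_upwards [hu] with n hn
    have hpos : 0 < q ^ d n := by positivity
    have h1 : u n / q ^ d n - v n = (u n - v n * q ^ d n) / q ^ d n := by field_simp
    rw [Real.norm_eq_abs, h1, abs_div, abs_of_pos hpos]
    exact div_le_div₀ ((abs_nonneg _).trans hn) hn (by positivity)
      (pow_le_pow_of_le_one hq0.le hq1 (hd n))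
  simpa using h.add hv

end Limits

section SequenceLimits

variable {p : ℝ} {x y z w : (n : ℕ) → Fin (n + 3)}

lemma tendsto_sum_PrGnm_mul_div (hp : p ∈ Set.Ioc (0 : ℝ) 1) (hxy : ∀ n, x n ≠ y n)
    (hzw : ∀ n, z n ≠ w n) :
    Tendsto (fun n => (∑ m ∈ Finset.range ((n + 3).choose 2 + 1),
        PrGnp (n + 3) p {f | edgeCount f = m} * (PrGnm (n + 3) m {f | ¬ Reaches f (x n) (y n)} *
          PrGnm (n + 3) m {f | ¬ Reaches f (z n) (w n)})) / (1 - p / 2) ^ (2 * (n + 3) - 2))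
      atTop (nhds (4 * Real.exp (2 * varParam p))) := by
  refine tendsto_div_of_abs_sub_mul_le (by linarith [hp.2]) (by linarith [hp.1])
    (fun n => Nat.sub_le (2 * (n + 3)) 2) (((tendsto_add_atTop_iff_nat 3).mpr
      (tendsto_hypergeomGF (varParam_nonneg hp))).const_mul 4)
    ((tendsto_add_atTop_iff_nat 3).mpr (tendsto_momentError_div hp)) ?_
  filter_upwards [eventually_ge_atTop 1] with n hn
  have h := abs_sum_PrGnm_mul_sub_le hp (show 4 ≤ n + 3 by omega) (hxy n) (hzw n)
  rwa [mul_right_comm] at h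

lemma tendsto_PrGnp_not_reaches_sq_div (hp : p ∈ Set.Ioc (0 : ℝ) 1) (hxy : ∀ n, x n ≠ y n) :
    Tendsto (fun n => PrGnp (n + 3) p {f | ¬ Reaches f (x n) (y n)} ^ 2 /
      (1 - p / 2) ^ (2 * (n + 3) - 2)) atTop (nhds 4) :=
  tendsto_div_of_abs_sub_mul_le (by linarith [hp.2]) (by linarith [hp.1])
    (fun n => Nat.sub_le (2 * (n + 3)) 2) tendsto_const_nhds
    ((tendsto_add_atTop_iff_nat 3).mpr (tendsto_momentError_div hp))
    (Eventually.of_forall fun n => abs_PrGnp_not_reaches_sq_sub_le hp (by omega) (hxy n))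

lemma tendsto_PrGnp_not_reaches_inter_div (hp : p ∈ Set.Ioc (0 : ℝ) 1) (hxy : ∀ n, x n ≠ y n)
    (hxz : ∀ n, x n ≠ z n) (hyz : ∀ n, y n ≠ z n) :
    Tendsto (fun n => PrGnp (n + 3) p
        ({f | ¬ Reaches f (y n) (x n)} ∩ {f | ¬ Reaches f (x n) (z n)}) /
      (1 - p / 2) ^ (2 * (n + 3) - 3)) atTop (nhds 3) := by
  refine tendsto_div_of_abs_sub_mul_le (by linarith [hp.2]) (by linarith [hp.1])
    (fun n => Nat.sub_le (2 * (n + 3)) 3) tendsto_const_nhds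
    ((tendsto_add_atTop_iff_nat 3).mpr (tendsto_jointError_div hp)) ?_
  filter_upwards [eventually_ge_atTop 4] with n hn
  exact abs_PrGnp_not_reaches_inter_sub_le hp (by omega) (hxy n) (hxz n) (hyz n)

end SequenceLimits

/-- Fix `p ∈ (0,1]` and distinct vertices `s, a, b` of `⃗G(n,p)`
(graphs on `n + 3` vertices); let `A := {a ↛ s}`, `B := {s ↛ b}` and `M` be the
number of edges of the underlying graph. Then, as `n → ∞`,
`E(Cov(A,B | M)) = (3 - (4-2p) e^{2p(1-p)/(2-p)²} + o(1)) (1-p/2)^(2n-3)` and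
`Var(P(A | M)) = 4 (e^{2p(1-p)/(2-p)²} - 1 + o(1)) (1-p/2)^(2n-2)`. -/
theorem quenched_terms_asymptotics
    (p : ℝ) (hp : p ∈ Set.Ioc (0 : ℝ) 1)
    (s a b : (n : ℕ) → Fin (n + 3))
    (hsa : ∀ n, s n ≠ a n) (hsb : ∀ n, s n ≠ b n) (hab : ∀ n, a n ≠ b n) :
    ∃ ε₁ ε₂ : ℕ → ℝ,
      Filter.Tendsto ε₁ Filter.atTop (nhds 0) ∧
      Filter.Tendsto ε₂ Filter.atTop (nhds 0) ∧
      ∀ n : ℕ,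
        ((∑ m ∈ Finset.range (Nat.choose (n + 3) 2 + 1),
            PrGnp (n + 3) p {f | edgeCount f = m} *
              (PrGnm (n + 3) m
                  ({f | ¬ Reaches f (a n) (s n)} ∩ {f | ¬ Reaches f (s n) (b n)}) -
                PrGnm (n + 3) m {f | ¬ Reaches f (a n) (s n)} *
                  PrGnm (n + 3) m {f | ¬ Reaches f (s n) (b n)})) =
          (3 - (4 - 2 * p) * Real.exp (2 * p * (1 - p) / (2 - p) ^ 2) + ε₁ n) *
            (1 - p / 2) ^ (2 * (n + 3) - 3)) ∧
        ((∑ m ∈ Finset.range (Nat.choose (n + 3) 2 + 1),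
            PrGnp (n + 3) p {f | edgeCount f = m} *
              (PrGnm (n + 3) m {f | ¬ Reaches f (a n) (s n)}) ^ 2) -
          (∑ m ∈ Finset.range (Nat.choose (n + 3) 2 + 1),
            PrGnp (n + 3) p {f | edgeCount f = m} *
              PrGnm (n + 3) m {f | ¬ Reaches f (a n) (s n)}) ^ 2 =
          4 * (Real.exp (2 * p * (1 - p) / (2 - p) ^ 2) - 1 + ε₂ n) *
            (1 - p / 2) ^ (2 * (n + 3) - 2)) := by
  have hq : 0 < 1 - p / 2 := by linarith [hp.2]
  have hexp : 2 * varParam p = 2 * p * (1 - p) / (2 - p) ^ 2 := by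
    rw [varParam]
    ring
  have hQ := tendsto_sum_PrGnm_mul_div hp (fun n => (hsa n).symm) hsb
  have hV := tendsto_sum_PrGnm_mul_div hp (fun n => (hsa n).symm) (fun n => (hsa n).symm)
  have hS := tendsto_PrGnp_not_reaches_sq_div hp (fun n => (hsa n).symm)
  have hJ := tendsto_PrGnp_not_reaches_inter_div hp hsa hsb hab
  rw [hexp] at hQ hV
  have h₁ := (hJ.sub (hQ.const_mul (1 - p / 2))).sub_const
    (3 - (4 - 2 * p) * Real.exp (2 * p * (1 - p) / (2 - p) ^ 2))
  have h₂ := ((hV.sub hS).const_mul (1 / 4)).sub_const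
    (Real.exp (2 * p * (1 - p) / (2 - p) ^ 2) - 1)
  refine ⟨_, _, (by convert h₁ using 2; ring), (by convert h₂ using 2; ring), fun n => ⟨?_, ?_⟩⟩
  · have hpow : 0 < (1 - p / 2) ^ (2 * (n + 3) - 3) := pow_pos hq _
    have hsucc : (1 - p / 2) ^ (2 * (n + 3) - 2) =
        (1 - p / 2) ^ (2 * (n + 3) - 3) * (1 - p / 2) := by
      rw [← pow_succ]
      congr 1
    simp_rw [mul_sub, Finset.sum_sub_distrib, sum_PrGnp_edgeCount_mul_PrGnm, hsucc]
    generalize (1 - p / 2) ^ (2 * (n + 3) - 3) = Q at *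
    generalize 1 - p / 2 = q at *
    field_simp
    ring
  · rw [sum_PrGnp_edgeCount_mul_PrGnm]
    have hpow : 0 < (1 - p / 2) ^ (2 * (n + 3) - 2) := pow_pos hq _
    simp_rw [sq (PrGnm _ _ _)]
    generalize (1 - p / 2) ^ (2 * (n + 3) - 2) = Q at *
    field_simp
    ring
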